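/- Let W = (P,[n]) be an admissible Wilson loop diagram with k propagators, Grassmann necklace (I_1^W,...,I_n^W), and notation as in the Algorithm. Then: (1) each Δ_{I_i} and each r_i is a homogeneous polynomial; (2) each Δ_{I_i} factors into irreducible factors of degree at most 2, where every linear factor is a single variable x_{p,a} and every irreducible quadratic factor is a 2×2 minor of C(W) of the form x_{p,a}x_{q,a+1} − x_{p,a+1}x_{q,a}; (3) an irreducible quadratic factor of Δ_{I_i} arises precisely when two propagators p and q are supported on a common edge a with I_i^W(p) = a and I_i^W(q) = a+1; (4) r_i divides Δ_{I_i} for every i; (5) the ideal generated by R = ∏_{i=1}^n r_i is the radical of the ideal generated by ∏_{i=1}^n Δ_{I_i} in the polynomial ring in the variables x_{p,q}. -/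

import Mathlib

open scoped Classical

namespace WLD

/-- A propagator of a Wilson loop diagram on the cyclically ordered vertex set
`ZMod n` (vertex `n` is identified with `0`): an unordered pair of edges, the
edge joining vertex `i` to vertex `i+1` being labelled `i`. -/
abbrev Prp (n : ℕ) := Sym2 (ZMod n)

variable (n : ℕ)

/-- The position of `x` in the linear order `i <_i i+1 <_i ⋯ <_i i-1`. -/
def ord (i x : ZMod n) : ℕ := (x - i).val

/-- The other end of a propagator `p` having an end on the edge `e`. -/
noncomputable def otherEnd (p : Prp n) (e : ZMod n) : ZMod n :=
  if h : e ∈ p then Sym2.Mem.other h else e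

/-- The vertex support `V(p) = {i, i+1, j, j+1}` of the propagator `p = (i,j)`. -/
def supp (p : Prp n) : Finset (ZMod n) :=
  Sym2.lift ⟨fun i j => {i, i + 1, j, j + 1}, fun i j => by
    ext x
    simp only [Finset.mem_insert, Finset.mem_singleton]
    tauto⟩ p

/-- The vertex support `V(Q)` of a set of propagators. -/
def suppSet (Q : Finset (Prp n)) : Finset (ZMod n) := Q.biUnion (supp n)

/-- `Prop(U)`: the propagators of `P` supported on (a vertex of) `U`. -/
noncomputable def propsOn (P : Finset (Prp n)) (U : Finset (ZMod n)) : Finset (Prp n) :=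
  P.filter fun p => (supp n p ∩ U).Nonempty

/-- Two propagators `p = (i,j)` and `q = (k,l)` cross if `i < k < j < l` cyclically. -/
def Crossing (p q : Prp n) : Prop :=
  ∃ i j k l : ZMod n, p = s(i, j) ∧ q = s(k, l) ∧
    0 < ord n i k ∧ ord n i k < ord n i j ∧ ord n i j < ord n i l

/-- Weak admissibility of a Wilson loop diagram. -/
structure IsWeaklyAdmissible (P : Finset (Prp n)) : Prop where
  dense : ∀ Q ⊆ P, Q.Nonempty → Q.card + 3 ≤ (suppSet n Q).card
  noncross : ∀ p ∈ P, ∀ q ∈ P, ¬ Crossing n p q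

/-- Admissibility of a Wilson loop diagram. -/
structure IsAdmissible (P : Finset (Prp n)) : Prop where
  card_add_four_le : P.card + 4 ≤ n
  dense : ∀ Q ⊆ P, Q.Nonempty → Q.card + 3 ≤ (suppSet n Q).card
  noncross : ∀ p ∈ P, ∀ q ∈ P, ¬ Crossing n p q

/-- The length of a propagator `p = (i,j)`:
`min(|[i+1, j]|, |[j+1, i]|)`, the number of vertices on its smaller side. -/
def plength (p : Prp n) : ℕ :=
  Sym2.lift ⟨fun i j => min ((j - i - 1).val + 1) ((i - j - 1).val + 1),
    fun _ _ => min_comm _ _⟩ p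

/-- `InsideDir n i p q` : the propagator `q = (k,l)` lies (weakly) inside the
propagator `p = (i,j)` directed from its end `i`, i.e. `i ≤_i k <_i l ≤_i j`. -/
def InsideDir (i : ZMod n) (p q : Prp n) : Prop :=
  ∃ j k l : ZMod n, p = s(i, j) ∧ q = s(k, l) ∧
    ord n i k < ord n i l ∧ ord n i l ≤ ord n i j

/-- Sorting key measuring how far clockwise of the vertex `a` the relevant end of
a propagator supported on `a` is attached: ends on the edge `a-1` are clockwise of
ends on the edge `a`, and on a fixed edge an end is the more clockwise the larger
the propagator is (nestedness of noncrossing propagators sharing an edge). -/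
noncomputable def cwKey (a : ZMod n) (p : Prp n) : ℕ :=
  if a - 1 ∈ p then n + ord n (a - 1) (otherEnd n p (a - 1))
  else ord n a (otherEnd n p a)

/-- The clockwise-most propagator of `S` supported on the vertex `a`, if any. -/
noncomputable def pickCW (S : Finset (Prp n)) (a : ZMod n) : Option (Prp n) :=
  if h : (S.filter fun p => a ∈ supp n p).Nonempty then
    some (Classical.choose
      ((S.filter fun p => a ∈ supp n p).exists_max_image (cwKey n a) h))
  else none

/-- The Grassmann necklace algorithm started at the vertex `i`: after `t` steps,
`(gnRun n P i t).1` is the set of propagators not yet deleted, and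
`(gnRun n P i t).2` records the vertex assigned to each deleted propagator.
Step `t+1` processes the vertex `i + t`: if some not-yet-deleted propagator is
supported on it, the clockwise-most such propagator is deleted and assigned
that vertex. -/
noncomputable def gnRun (P : Finset (Prp n)) (i : ZMod n) :
    ℕ → Finset (Prp n) × (Prp n → Option (ZMod n))
  | 0 => (P, fun _ => none)
  | t + 1 =>
    match pickCW n (gnRun P i t).1 (i + (t : ZMod n)) with
    | none => gnRun P i t
    | some p => ((gnRun P i t).1.erase p,
        Function.update (gnRun P i t).2 p (some (i + (t : ZMod n))))

/-- `I_i^W(p)`: the vertex contributed by the propagator `p` to the Grassmann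
necklace term `I_i^W` (as an `Option`; the algorithm makes one full circuit of
the vertex set, i.e. runs for `n` steps). -/
noncomputable def gnAssign (P : Finset (Prp n)) (i : ZMod n) (p : Prp n) :
    Option (ZMod n) :=
  (gnRun n P i n).2 p

/-- The Grassmann necklace term `I_i^W` produced by the algorithm. -/
noncomputable def gnSet [NeZero n] (P : Finset (Prp n)) (i : ZMod n) :
    Finset (ZMod n) :=
  Finset.univ.filter fun v => ∃ p, gnAssign n P i p = some v

/-- The cyclic interval `{a, a+1, …, a + (len-1)}` in `ZMod n`. -/
def cInterval [NeZero n] (a : ZMod n) (len : ℕ) : Finset (ZMod n) :=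
  Finset.univ.filter fun x => ord n a x < len

/-- A Grassmann necklace of type `(k, n)`: a cyclic sequence of `k`-element
subsets of the vertex set such that `I_{i+1} = (I_i \ {i}) ∪ {j}` for some `j`
whenever `i ∈ I_i`, and `I_{i+1} = I_i` otherwise. -/
def IsGrassmannNecklace [NeZero n] (k : ℕ) (I : ZMod n → Finset (ZMod n)) : Prop :=
  (∀ i, (I i).card = k) ∧
  ∀ i : ZMod n,
    (i ∈ I i → ∃ j : ZMod n, I (i + 1) = insert j ((I i).erase i)) ∧
    (i ∉ I i → I (i + 1) = I i)

/-- Independence in the matroid `M(W)`: no subset `U` of `J` supports fewer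
propagators than the vertices it contains. -/
def Indep (P : Finset (Prp n)) (J : Finset (ZMod n)) : Prop :=
  ∀ U ⊆ J, U.card ≤ (propsOn n P U).card

/-- `A` is lexicographically smaller than `B` with respect to the order `<_i`:
the `<_i`-least element of the symmetric difference lies in `A`. -/
def LexLt (i : ZMod n) (A B : Finset (ZMod n)) : Prop :=
  ∃ v, v ∈ A ∧ v ∉ B ∧ ∀ w, ord n i w < ord n i v → (w ∈ A ↔ w ∈ B)

/-- A `+` is placed in the box `(a, b)` of the Le diagram with row labels `I₁`
by the necklace term `Ii`: writing `I₁ \ Ii = {a₁ > ⋯ > a_r}` and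
`Ii \ I₁ = {b₁ < ⋯ < b_r}` in the `<₁` order, the plusses are in the boxes
`(a_t, b_t)`. -/
def LePlusAt (I₁ Ii : Finset (ZMod n)) (a b : ZMod n) : Prop :=
  a ∈ I₁ \ Ii ∧ b ∈ Ii \ I₁ ∧
    ((I₁ \ Ii).filter fun x => ord n 1 a < ord n 1 x).card =
      ((Ii \ I₁).filter fun y => ord n 1 y < ord n 1 b).card

/-- The box `(a, b)` of the Le diagram of the diagram `P` contains a `+`. -/
def LePlus [NeZero n] (P : Finset (Prp n)) (a b : ZMod n) : Prop :=
  ∃ i : ZMod n, LePlusAt n (gnSet n P 1) (gnSet n P i) a b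

/-- The number of `+` entries in the Le diagram of the diagram `P`. -/
noncomputable def plusCount [NeZero n] (P : Finset (Prp n)) : ℕ :=
  (Finset.univ.filter fun ab : ZMod n × ZMod n => LePlus n P ab.1 ab.2).card

/-- The length of the row labelled `a` of the Young diagram with row labels `I₁`
(the boxes of row `a` are indexed by the column labels `b ∉ I₁` with `a <₁ b`). -/
noncomputable def rowLen [NeZero n] (I₁ : Finset (ZMod n)) (a : ZMod n) : ℕ :=
  (Finset.univ.filter fun b => b ∉ I₁ ∧ ord n 1 a < ord n 1 b).card

/-- The entry of the matrix `C(W)` in row `p` and column `q`: the indeterminate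
`x_{p,q}` if `q ∈ V(p)`, and `0` otherwise. -/
noncomputable def CW (p : Prp n) (q : ZMod n) : MvPolynomial (Prp n × ZMod n) ℝ :=
  if q ∈ supp n p then MvPolynomial.X (p, q) else 0

/-- The column paired with the row `p` in the minors determined by `I_i^W`. -/
noncomputable def colOf (P : Finset (Prp n)) (i : ZMod n) (p : Prp n) : ZMod n :=
  (gnAssign n P i p).getD i

/-- `Δ_{I_i}`: the determinant of the `k × k` minor of `C(W)` on the columns
indexed by `I_i^W`, rows and columns paired via the necklace assignment. -/
noncomputable def Delta (P : Finset (Prp n)) (i : ZMod n) :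
    MvPolynomial (Prp n × ZMod n) ℝ :=
  Matrix.det (Matrix.of fun p q : ↥P => CW n (p : Prp n) (colOf n P i (q : Prp n)))

/-- `S_i`: the propagators whose contribution changes from `I_{i-1}` to `I_i`. -/
noncomputable def Schanged (P : Finset (Prp n)) (i : ZMod n) : Finset (Prp n) :=
  P.filter fun p => gnAssign n P (i - 1) p ≠ gnAssign n P i p

/-- `r_i`: the determinant of the minor of `C(W)` with rows indexed by `S_i` and
columns indexed by `I_i(S_i)` (equal to `1` when `S_i = ∅`). -/
noncomputable def rfac (P : Finset (Prp n)) (i : ZMod n) :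
    MvPolynomial (Prp n × ZMod n) ℝ :=
  Matrix.det
    (Matrix.of fun p q : ↥(Schanged n P i) => CW n (p : Prp n) (colOf n P i (q : Prp n)))

/-- `R = ∏ᵢ rᵢ`, the polynomial produced by the algorithm. -/
noncomputable def Rpoly [NeZero n] (P : Finset (Prp n)) :
    MvPolynomial (Prp n × ZMod n) ℝ :=
  ∏ i : ZMod n, rfac n P i

/-- Position of the end of the propagator `p` along the edge `e`: larger values
attach closer to the vertex `e`, i.e. earlier in the counterclockwise ordering
of the ends of propagators along the edge `e`. -/
noncomputable def edgeKey (e : ZMod n) (p : Prp n) : ℕ := ord n e (otherEnd n p e)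

/-- The propagators of `P` with an end on the edge `e`. -/
noncomputable def onEdge (P : Finset (Prp n)) (e : ZMod n) : Finset (Prp n) :=
  P.filter fun p => e ∈ p

/-- `p` is the first propagator (`p₁`) on the edge `e` in the counterclockwise
ordering of the propagators with an end on the edge `e`. -/
def IsCcwFirst (P : Finset (Prp n)) (e : ZMod n) (p : Prp n) : Prop :=
  p ∈ onEdge n P e ∧ ∀ q ∈ onEdge n P e, edgeKey n e q ≤ edgeKey n e p

/-- `p` is the last propagator (`p_r`) on the edge `e` in the counterclockwise
ordering of the propagators with an end on the edge `e`. -/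
def IsCcwLast (P : Finset (Prp n)) (e : ZMod n) (p : Prp n) : Prop :=
  p ∈ onEdge n P e ∧ ∀ q ∈ onEdge n P e, edgeKey n e p ≤ edgeKey n e q

/-- `p` and `q` are consecutive, in this order (`p = p_j`, `q = p_{j+1}`), in the
counterclockwise ordering of the propagators with an end on the edge `e`. -/
def ConsecOnEdge (P : Finset (Prp n)) (e : ZMod n) (p q : Prp n) : Prop :=
  p ∈ onEdge n P e ∧ q ∈ onEdge n P e ∧ edgeKey n e q < edgeKey n e p ∧
    ∀ r ∈ onEdge n P e, ¬ (edgeKey n e q < edgeKey n e r ∧ edgeKey n e r < edgeKey n e p)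

/-- The factor `R_e` of the denominator `R(W)` associated to the edge `e`:
`R_e = x_{p₁,e+1} • ∏_{j=1}^{r-1} (x_{p_j,e} x_{p_{j+1},e+1} - x_{p_{j+1},e} x_{p_j,e+1}) • x_{p_r,e}`
for the counterclockwise ordering `p₁, …, p_r` of the propagators on the edge `e`
(`R_e = 1` if there are none). -/
noncomputable def Redge (P : Finset (Prp n)) (e : ZMod n) :
    MvPolynomial (Prp n × ZMod n) ℝ :=
  (∏ p ∈ (onEdge n P e).filter (IsCcwFirst n P e), MvPolynomial.X (p, e + 1)) *
    (∏ pq ∈ (P ×ˢ P).filter (fun pq => ConsecOnEdge n P e pq.1 pq.2),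
      (MvPolynomial.X (pq.1, e) * MvPolynomial.X (pq.2, e + 1) -
        MvPolynomial.X (pq.2, e) * MvPolynomial.X (pq.1, e + 1))) *
    (∏ p ∈ (onEdge n P e).filter (IsCcwLast n P e), MvPolynomial.X (p, e))

/-- The denominator `R(W) = ∏ₑ R_e` of the integrand `Ω(W)`. -/
noncomputable def RW [NeZero n] (P : Finset (Prp n)) :
    MvPolynomial (Prp n × ZMod n) ℝ :=
  ∏ e : ZMod n, Redge n P e

/-- The relabelling map associated to the removal of the vertex `i` from the
vertex set `ZMod n`: the vertex of `ZMod (n-1)` in position `t` (in the `<₁`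
order) is sent to the vertex of `ZMod n` in position `t` if `t` precedes the
position of `i`, and to the vertex in position `t+1` otherwise. -/
noncomputable def liftVert (i : ZMod n) (x : ZMod (n - 1)) : ZMod n :=
  1 + ((if ord (n - 1) 1 x < ord n 1 i then ord (n - 1) 1 x
        else ord (n - 1) 1 x + 1 : ℕ) : ZMod n)

end WLD

namespace WLD

/-- The clockwise priority, at position `t` of the linear order, of a propagator with ends
`k < a`, as a natural number. -/
def linKey (n t k a : ℕ) : ℕ :=
  if t = k then n + (a - k) else if t = a then n + (k + n - a)
  else if t + 1 = k then a - k else k + n - a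

/-- Position `t` lies in the support of a propagator with ends `k < a`. -/
def Meets (t k a : ℕ) : Prop := t = k ∨ t + 1 = k ∨ t = a ∨ t + 1 = a

/-- The greedy assignment of propagators with ends `k p < a p` to the positions `0, …, n - 1`:
`T p` is the position at which `p` is deleted. -/
structure LinModel (ι : Type*) (n : ℕ) (k a T : ι → ℕ) : Prop where
  gap : ∀ p, k p + 2 ≤ a p
  lt : ∀ p, a p < n
  inj : ∀ p q, k p = k q → a p = a q → p = q
  noncross : ∀ p q, k p < k q → k q < a p → a q ≤ a p
  meets : ∀ p, T p + 1 < n → Meets (T p) (k p) (a p)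
  T_inj : ∀ p q, T p + 1 < n → T p = T q → p = q
  greedy : ∀ p t, t + 1 < n → Meets t (k p) (a p) → t < T p →
    ∃ q, T q = t ∧ linKey n t (k p) (a p) < linKey n t (k q) (a q)

namespace LinModel
variable {ι : Type*} {n : ℕ} {k a T : ι → ℕ}

theorem T_lt (h : LinModel ι n k a T) (p : ι) : T p < a p := by
  suffices H : ∀ m, ∀ p, a p = m → T p < a p from H _ p rfl
  intro m
  induction m using Nat.strong_induction_on with
  | _ m ih =>
    rintro p rfl
    by_contra hc
    have hg := h.gap p
    have hl := h.lt p
    obtain ⟨q, hq, hk⟩ := h.greedy p (a p - 1) (by omega)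
      (by unfold Meets; omega) (by omega)
    have hm := h.meets q (by omega)
    have hgq := h.gap q
    have hlq := h.lt q
    have h1 := h.noncross p q
    have ih1 := fun hh => ih (a q) hh q rfl
    unfold Meets at hm
    unfold linKey at hk
    have h2 : a q = a p ∧ k p < k q := by split_ifs at hk <;> omega
    obtain ⟨r, hr, hk'⟩ := h.greedy q (k q) (by omega)
      (by unfold Meets; omega) (by omega)
    have hm' := h.meets r (by omega)
    have hgr := h.gap r
    have hlr := h.lt r
    have h1' := h.noncross p r
    have ih1' := fun hh => ih (a r) hh r rfl
    unfold Meets at hm'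
    unfold linKey at hk'
    split_ifs at hk' <;> omega

theorem T_cases (h : LinModel ι n k a T) (p : ι) :
    T p = k p ∨ T p + 1 = k p ∨ T p + 1 = a p := by
  have h1 := h.T_lt p
  have h2 := h.meets p (by have := h.lt p; omega)
  unfold Meets at h2
  omega

/-- A propagator assigned at its right end was beaten at its left edge. -/
theorem exists_outer (h : LinModel ι n k a T) (q : ι) (hq : T q + 1 = a q) :
    ∃ r, k r = k q ∧ a q < a r ∧ T r = k q := by
  have hg := h.gap q
  have hl := h.lt q
  obtain ⟨r, hr, hk⟩ := h.greedy q (k q) (by omega) (by unfold Meets; omega) (by omega)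
  have := h.T_cases r
  have := h.T_lt r
  have := h.gap r
  have := h.lt r
  refine ⟨r, ?_⟩
  unfold linKey at hk
  split_ifs at hk <;> omega

theorem le_of_right (h : LinModel ι n k a T) (q p : ι) (hq : T q + 1 = a q)
    (hp : a p = a q) : k q ≤ k p := by
  obtain ⟨r, h1, h2, h3⟩ := h.exists_outer q hq
  have := h.noncross p r
  have := h.gap q
  omega

/-- The digraph of non-zero entries: column of `p`, row `q`. -/
def Edge (k a T : ι → ℕ) (p q : ι) : Prop := Meets (T p) (k q) (a q)

/-- `p` lies inside `q`. -/
def In (k a : ι → ℕ) (q p : ι) : Prop := k q ≤ k p ∧ a p ≤ a q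

theorem in_closed (h : LinModel ι n k a T) (q p r : ι)
    (hq : T q + 1 = a q ∨ T q = k q) (hin : In k a q p) (hne : p ≠ q)
    (he : Edge k a T p r) : In k a q r ∧ r ≠ q := by
  have hT : k q + 1 ≤ T p ∧ T p + 2 ≤ a q := by
    have hp := h.T_cases p
    have := h.gap p
    have := h.gap q
    have := h.lt q
    have := h.lt p
    have hi := h.inj p q
    have hTi := h.T_inj p q
    unfold In at hin
    have hk : T p ≠ k q := by
      rcases hq with hq | hq
      · obtain ⟨r, h1, h2, h3⟩ := h.exists_outer q hq
        intro hh
        have : p = r := h.T_inj p r (by omega) (by omega)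
        subst this
        omega
      · intro hh
        exact hne (hTi (by omega) (by omega))
    have hk' : T p + 1 ≠ k q := by
      intro hh
      obtain ⟨r, h1, h2⟩ := h.greedy q (T p) (by omega) (by unfold Meets; omega) (by omega)
      have : r = p := h.T_inj r p (by omega) (by omega)
      subst this
      unfold linKey at h2
      split_ifs at h2 <;> omega
    have hr : T p + 1 ≠ a q := by
      intro hh
      have : a p = a q := by omega
      have := h.le_of_right p q (by omega) (by omega)
      exact hne (hi (by omega) (by omega))
    omega
  unfold Edge Meets at he
  have := h.noncross q r
  have := h.noncross r q
  have := h.gap r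
  constructor
  · unfold In
    omega
  · rintro rfl
    omega

open Relation

theorem in_closed_trans (h : LinModel ι n k a T) (q p r : ι)
    (hq : T q + 1 = a q ∨ T q = k q) (hin : In k a q p) (hne : p ≠ q)
    (he : ReflTransGen (Edge k a T) p r) : In k a q r ∧ r ≠ q := by
  induction he with
  | refl => exact ⟨hin, hne⟩
  | tail _ he ih => exact h.in_closed q _ _ hq ih.1 ih.2 he

/-- Everything reachable from `q` assigned at its right end. -/
theorem right_closed (h : LinModel ι n k a T) (q p r : ι) (hq : T q + 1 = a q)
    (hin : In k a q p ∨ ∃ b, k b = a q ∧ T b = a q ∧ In k a b p)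
    (he : Edge k a T p r) :
    In k a q r ∨ ∃ b, k b = a q ∧ T b = a q ∧ In k a b r := by
  have hgq := h.gap q
  have hgr := h.gap r
  have hlr := h.lt r
  have hlq := h.lt q
  rcases hin with hin | ⟨b, hb1, hb2, hin⟩
  · by_cases hne : p = q
    · subst hne
      unfold Edge Meets at he
      have h1 := h.noncross p r
      have h2 := h.noncross r p
      have h3 := h.le_of_right p r hq
      by_cases hk : k r = a p
      · right
        have h4 := h.T_cases r
        have h5 : T r + 1 ≠ k r := by
          intro h6
          have : p = r := h.T_inj p r (by omega) (by omega)
          subst this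
          omega
        by_cases h6 : T r = k r
        · exact ⟨r, hk, by omega, le_rfl, le_rfl⟩
        · obtain ⟨b, hb1, hb2, hb3⟩ := h.exists_outer r (by omega)
          exact ⟨b, by omega, by omega, by omega, by omega⟩
      · left
        unfold In
        omega
    · exact Or.inl (h.in_closed q p r (Or.inl hq) hin hne he).1
  · by_cases hne : p = b
    · subst hne
      unfold Edge Meets at he
      have h1 := h.noncross p r
      have h2 := h.noncross r p
      have h3 := h.le_of_right q r hq
      have hgp := h.gap p
      by_cases hk : k r = a q
      · right
        refine ⟨p, hb1, hb2, by omega, ?_⟩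
        by_contra h4
        have h5 := h.T_cases r
        have h6 : T r ≠ k r := by
          intro h6
          have : p = r := h.T_inj p r (by omega) (by omega)
          subst this
          omega
        have h7 : T r + 1 ≠ k r := by
          intro h7
          have : q = r := h.T_inj q r (by omega) (by omega)
          subst this
          omega
        obtain ⟨b, hb3, hb4, hb5⟩ := h.exists_outer r (by omega)
        have : b = p := h.T_inj b p (by omega) (by omega)
        subst this
        omega
      · by_cases hk' : k r = a q + 1
        · right
          exact ⟨p, hb1, hb2, by omega, by omega⟩
        · left
          have := h.noncross q r
          have := h.noncross r q
          unfold In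
          omega
    · exact Or.inr ⟨b, hb1, hb2, (h.in_closed b p r (Or.inr (by omega)) hin hne he).1⟩

/-- The assigned positions are the two vertices of a common edge. -/
def Mates (k a T : ι → ℕ) (p q : ι) : Prop :=
  ∃ e, (e = k p ∨ e = a p) ∧ (e = k q ∨ e = a q) ∧ T p + 1 = e ∧ T q = e

theorem right_scc (h : LinModel ι n k a T) (q p : ι) (hq : T q + 1 = a q)
    (h1 : ReflTransGen (Edge k a T) q p) (h2 : ReflTransGen (Edge k a T) p q) :
    p = q ∨ (k p = a q ∧ T p = a q) := by
  have H : In k a q p ∨ ∃ b, k b = a q ∧ T b = a q ∧ In k a b p := by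
    clear h2
    induction h1 with
    | refl => exact Or.inl ⟨le_rfl, le_rfl⟩
    | tail _ he ih => exact h.right_closed q _ _ hq ih he
  have hgq := h.gap q
  rcases H with H | ⟨b, hb1, hb2, H⟩
  · by_contra hc
    exact (h.in_closed_trans q p q (Or.inl hq) H (by tauto) h2).2 rfl
  · by_cases hpb : p = b
    · subst hpb
      exact Or.inr ⟨hb1, hb2⟩
    · have := (h.in_closed_trans b p q (Or.inr (by omega)) H hpb h2).1
      unfold In at this
      omega

theorem k_le_of_edge (h : LinModel ι n k a T) (p q : ι) (hp : T p + 1 ≠ a p)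
    (he : Edge k a T p q) (hr : ReflTransGen (Edge k a T) q p) : k q ≤ k p := by
  by_contra hc
  have h1 := h.T_cases p
  have h2 := h.gap p
  have h3 := h.gap q
  have h4 := h.noncross p q
  unfold Edge Meets at he
  have := h.in_closed_trans p q p (Or.inr (by omega)) (by unfold In; omega)
    (by rintro rfl; omega) hr
  exact this.2 rfl

theorem mates_of_reach (h : LinModel ι n k a T) (p q : ι) (hne : p ≠ q)
    (h1 : ReflTransGen (Edge k a T) p q) (h2 : ReflTransGen (Edge k a T) q p) :
    Mates k a T p q ∨ Mates k a T q p := by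
  by_cases hz : ∃ z, ReflTransGen (Edge k a T) p z ∧ ReflTransGen (Edge k a T) z p ∧
      T z + 1 = a z
  · obtain ⟨z, hz1, hz2, hz3⟩ := hz
    have hp := h.right_scc z p hz3 hz2 hz1
    have hq := h.right_scc z q hz3 (hz2.trans h1) (h2.trans hz1)
    rcases hp with rfl | hp
    · rcases hq with rfl | hq
      · exact absurd rfl hne
      · exact Or.inl ⟨a p, by omega, by omega, hz3, hq.2⟩
    · rcases hq with rfl | hq
      · exact Or.inr ⟨a q, by omega, by omega, hz3, hp.2⟩
      · exact absurd (h.T_inj p q (by have := h.lt p; have := h.gap p; omega) (by omega)) hne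
  · push Not at hz
    have key : ∀ x y, ReflTransGen (Edge k a T) x y → ReflTransGen (Edge k a T) p x →
        ReflTransGen (Edge k a T) y p → k y ≤ k x := by
      intro x y hxy hpx hyp
      induction hxy with
      | refl => exact le_rfl
      | @tail b c hb he ih =>
        have hcb : ReflTransGen (Edge k a T) c b := hyp.trans (hpx.trans hb)
        have hbp : ReflTransGen (Edge k a T) b p := (ReflTransGen.single he).trans hyp
        exact (h.k_le_of_edge b c (hz b (hpx.trans hb) hbp) he hcb).trans (ih hbp)
    have h3 := key p q h1 .refl h2
    have h4 := key q p h2 h1 .refl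
    have h5 := h.T_cases p
    have h6 := h.T_cases q
    have h7 := hz p .refl .refl
    have h8 := hz q h1 h2
    have h9 := h.T_inj p q
    have := h.T_lt p
    have := h.lt p
    by_cases h10 : T p = k p
    · right
      refine ⟨k p, by omega, by omega, ?_, h10⟩
      by_contra hc
      exact hne (h9 (by omega) (by omega))
    · left
      refine ⟨k p, by omega, by omega, by omega, ?_⟩
      by_contra hc
      exact hne (h9 (by omega) (by omega))

end LinModel

section Determinants
open Relation

/-- The factor that the index `p` contributes to a determinant which splits into `1 × 1` blocks
and `2 × 2` blocks on the pairs related by `low`; the lower index of a pair carries the block. -/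
noncomputable def pairFactor {ι R : Type*} [CommRing R] (M : Matrix ι ι R)
    (low : ι → ι → Prop) (p : ι) : R :=
  if h : ∃ q, low p q then M p p * M h.choose h.choose - M p h.choose * M h.choose p
  else if ∃ q, low q p then 1 else M p p

theorem pairFactor_low {ι R : Type*} [CommRing R] (M : Matrix ι ι R) (low : ι → ι → Prop)
    {p q : ι} (h : low p q) (hu : ∀ q', low p q' → q' = q) :
    pairFactor M low p = M p p * M q q - M p q * M q p := by
  have h' : ∃ q, low p q := ⟨q, h⟩
  rw [pairFactor, dif_pos h', hu _ h'.choose_spec]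

theorem pairFactor_high {ι R : Type*} [CommRing R] (M : Matrix ι ι R) (low : ι → ι → Prop)
    {p q : ι} (h : low q p) (hu : ∀ q', ¬ low p q') : pairFactor M low p = 1 := by
  rw [pairFactor, dif_neg (by simpa using hu), if_pos ⟨q, h⟩]

theorem pairFactor_single {ι R : Type*} [CommRing R] (M : Matrix ι ι R) (low : ι → ι → Prop)
    {p : ι} (h : ∀ q, ¬ low q p) (hu : ∀ q, ¬ low p q) : pairFactor M low p = M p p := by
  rw [pairFactor, dif_neg (by simpa using hu), if_neg (by simpa using h)]

theorem det_toSquareBlock_pair {ι R α : Type*} [Fintype ι] [DecidableEq ι] [CommRing R]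
    [DecidableEq α] (M : Matrix ι ι R) (b : ι → α) (c : α) {p q : ι} (hne : p ≠ q)
    (hb : ∀ x, b x = c ↔ x = p ∨ x = q) :
    (M.toSquareBlock b c).det = M p p * M q q - M p q * M q p := by
  let f : Fin 2 → {x // b x = c} := ![⟨p, (hb p).2 (Or.inl rfl)⟩, ⟨q, (hb q).2 (Or.inr rfl)⟩]
  have hf : Function.Bijective f := by
    constructor
    · intro i j
      fin_cases i <;> fin_cases j <;> simp [f, hne, hne.symm]
    · rintro ⟨x, hx⟩
      rcases (hb x).1 hx with rfl | rfl
      · exact ⟨0, rfl⟩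
      · exact ⟨1, rfl⟩
  rw [← Matrix.det_submatrix_equiv_self (Equiv.ofBijective f hf), Matrix.det_fin_two]
  rfl

theorem det_toSquareBlock_single {ι R α : Type*} [Fintype ι] [DecidableEq ι] [CommRing R]
    [DecidableEq α] (M : Matrix ι ι R) (b : ι → α) (c : α) {p : ι}
    (hb : ∀ x, b x = c ↔ x = p) :
    (M.toSquareBlock b c).det = M p p := by
  have : Subsingleton {x // b x = c} :=
    ⟨fun x y => Subtype.ext (((hb _).1 x.2).trans ((hb _).1 y.2).symm)⟩
  rw [Matrix.det_eq_elem_of_subsingleton _ ⟨p, (hb p).2 rfl⟩]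
  rfl

theorem exists_blockTriangular.{u, v} {ι : Type u} {R : Type v} [Fintype ι] [DecidableEq ι] [CommRing R]
    (M : Matrix ι ι R) : ∃ (α : Type u) (_ : LinearOrder α) (b : ι → α), M.BlockTriangular b ∧
      ∀ p q, b p = b q ↔ ReflTransGen (fun x y => M y x ≠ 0) p q ∧
        ReflTransGen (fun x y => M y x ≠ 0) q p := by
  let _ : Preorder ι :=
    { le := fun x y => ReflTransGen (fun x y => M y x ≠ 0) y x
      le_refl := fun _ => .refl
      le_trans := fun _ _ _ h1 h2 => h2.trans h1 }
  refine ⟨LinearExtension (Antisymmetrization ι (· ≤ ·)), inferInstance,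
    fun p => toLinearExtension (toAntisymmetrization (· ≤ ·) p), ?_, ?_⟩
  · intro i j hij
    by_contra hM
    have h1 : i ≤ j := ReflTransGen.single hM
    have h2 : toAntisymmetrization (· ≤ ·) i ≤ toAntisymmetrization (· ≤ ·) j :=
      toAntisymmetrization_le_toAntisymmetrization_iff.2 h1
    exact absurd (toLinearExtension.monotone h2) (not_le.2 hij)
  · intro p q
    have h : toLinearExtension (toAntisymmetrization (· ≤ ·) p) =
      toLinearExtension (toAntisymmetrization (· ≤ ·) q) ↔
      toAntisymmetrization (· ≤ ·) p = toAntisymmetrization (· ≤ ·) q := Iff.rfl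
    rw [h]
    constructor
    · intro hh
      have := Quotient.exact hh
      exact ⟨this.2, this.1⟩
    · rintro ⟨h1, h2⟩
      exact Quotient.sound ⟨h2, h1⟩

theorem det_eq_prod_pairFactor {ι R : Type*} [Fintype ι] [DecidableEq ι] [CommRing R]
    (M : Matrix ι ι R) (low : ι → ι → Prop)
    (hscc : ∀ p q, p ≠ q → ReflTransGen (fun x y => M y x ≠ 0) p q →
      ReflTransGen (fun x y => M y x ≠ 0) q p → low p q ∨ low q p)
    (hlow : ∀ p q, low p q → M p q ≠ 0 ∧ M q p ≠ 0)
    (hr : ∀ p q q', low p q → low p q' → q' = q)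
    (hlr : ∀ p q r, low p q → ¬ low q r) :
    M.det = ∏ p, pairFactor M low p := by
  obtain ⟨α, _, b, hbt, hb⟩ := exists_blockTriangular M
  have hb' : ∀ p q, b p = b q ↔ p = q ∨ low p q ∨ low q p := by
    intro p q
    rw [hb]
    constructor
    · rintro ⟨h1, h2⟩
      by_cases hpq : p = q
      · exact Or.inl hpq
      · exact Or.inr (hscc p q hpq h1 h2)
    · rintro (rfl | h | h)
      · exact ⟨.refl, .refl⟩
      · exact ⟨.single (hlow _ _ h).2, .single (hlow _ _ h).1⟩
      · exact ⟨.single (hlow _ _ h).1, .single (hlow _ _ h).2⟩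
  have hfib : ∀ p, (M.toSquareBlock b (b p)).det =
      ∏ x ∈ Finset.univ.filter (fun x => b x = b p), pairFactor M low x := by
    have pair : ∀ p q, low p q → ∀ c, b p = c → (M.toSquareBlock b c).det =
        ∏ x ∈ Finset.univ.filter (fun x => b x = c), pairFactor M low x := by
      rintro p q h c rfl
      have hne : p ≠ q := by
        rintro rfl
        exact hlr _ _ _ h h
      have hx : ∀ x, b x = b p ↔ x = p ∨ x = q := by
        intro x
        rw [hb']
        constructor
        · rintro (h1 | h1 | h1)
          · exact Or.inl h1
          · exact absurd h (hlr _ _ _ h1)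
          · exact Or.inr (hr _ _ _ h h1)
        · rintro (rfl | rfl)
          · exact Or.inl rfl
          · exact Or.inr (Or.inr h)
      have hfil : Finset.univ.filter (fun x => b x = b p) = {p, q} := by
        ext x
        simp [hx]
      rw [det_toSquareBlock_pair M b _ hne hx, hfil, Finset.prod_pair hne,
        pairFactor_low M low h (fun q' h' => hr _ _ _ h h'),
        pairFactor_high M low h (hlr _ _ · h), mul_one]
    intro p
    by_cases h1 : ∃ q, low p q
    · obtain ⟨q, h⟩ := h1
      exact pair p q h _ rfl
    · by_cases h2 : ∃ q, low q p
      · obtain ⟨q, h⟩ := h2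
        exact pair q p h _ ((hb' _ _).2 (Or.inr (Or.inl h)))
      · push Not at h1 h2
        have hx : ∀ x, b x = b p ↔ x = p := by
          intro x
          rw [hb']
          have := h1 x
          have := h2 x
          tauto
        have hfil : Finset.univ.filter (fun x => b x = b p) = {p} := by
          ext x
          simp [hx]
        rw [det_toSquareBlock_single M b _ hx, hfil, Finset.prod_singleton,
          pairFactor_single M low h2 h1]
  rw [hbt.det, ← Finset.prod_fiberwise_of_maps_to
    (fun x _ => Finset.mem_image_of_mem b (Finset.mem_univ x))]
  refine Finset.prod_congr rfl fun c hc => ?_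
  obtain ⟨p, -, rfl⟩ := Finset.mem_image.1 hc
  exact hfib p

end Determinants

section Minor
open MvPolynomial

theorem isHomogeneous_det {ι σ R : Type*} [Fintype ι] [DecidableEq ι] [CommRing R]
    (M : Matrix ι ι (MvPolynomial σ R)) (h : ∀ i j, (M i j).IsHomogeneous 1) :
    M.det.IsHomogeneous (Fintype.card ι) := by
  rw [Matrix.det_apply]
  refine IsHomogeneous.sum _ _ _ fun τ _ => ?_
  have h1 : (∏ i, M (τ i) i).IsHomogeneous (Fintype.card ι) := by
    simpa using IsHomogeneous.prod Finset.univ (fun i => M (τ i) i) (fun _ => 1)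
      (fun i _ => h _ _)
  rcases Int.units_eq_one_or (Equiv.Perm.sign τ) with hs | hs <;> rw [hs]
  · simpa using h1
  · simpa using h1.neg

theorem irreducible_minor {σ K : Type*} [Field K] {a b c d : σ} (hab : a ≠ b)
    (hac : a ≠ c) (had : a ≠ d) (hbc : b ≠ c) (hbd : b ≠ d) :
    Irreducible (X a * X b - X c * X d : MvPolynomial σ K) := by
  classical
  rw [sub_eq_add_neg]
  have hX : Irreducible (X a : MvPolynomial σ K) := (X_prime (i := a)).irreducible
  refine irreducible_mul_X_add _ _ b (X_ne_zero a) ?_ ?_ ?_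
  · simpa [vars_X] using hab.symm
  · rw [vars_neg]
    intro h
    have := vars_mul _ _ h
    simp [vars_X, hbc, hbd] at this
  · rw [hX.isRelPrime_iff_not_dvd, dvd_neg]
    intro h
    rcases (X_prime (i := a)).dvd_or_dvd h with h | h
    · exact hac (X_dvd_X.1 h)
    · exact had (X_dvd_X.1 h)

theorem vars_minor {σ K : Type*} [DecidableEq σ] [Field K] {a b c d : σ}
    (hac : a ≠ c) (had : a ≠ d) :
    (X a * X b - X c * X d : MvPolynomial σ K).vars = {a, b, c, d} := by
  apply Finset.Subset.antisymm
  · refine (vars_sub_subset _).trans ?_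
    intro x hx
    rcases Finset.mem_union.1 hx with hx | hx <;> have := vars_mul _ _ hx <;>
      simp [vars_X] at this <;> simp <;> tauto
  · have hne : Finsupp.single a 1 + Finsupp.single b 1 ≠
        (Finsupp.single c 1 + Finsupp.single d 1 : σ →₀ ℕ) := by
      intro h
      have := DFunLike.congr_fun h a
      simp [Finsupp.single_apply, hac.symm, had.symm] at this
    have e : ∀ a b : σ, (X a * X b : MvPolynomial σ K) =
        monomial (Finsupp.single a 1 + Finsupp.single b 1) 1 := by
      intro a b
      simp [X, monomial_mul]
    intro x hx
    rw [mem_vars_iff_mem_support]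
    simp only [Finset.mem_insert, Finset.mem_singleton] at hx
    rcases hx with hx | hx | hx | hx
    · refine ⟨Finsupp.single a 1 + Finsupp.single b 1, ?_, ?_⟩
      · simp [e, coeff_monomial, hne.symm]
      · simp [hx]
    · refine ⟨Finsupp.single a 1 + Finsupp.single b 1, ?_, ?_⟩
      · simp [e, coeff_monomial, hne.symm]
      · simp [hx]
    · refine ⟨Finsupp.single c 1 + Finsupp.single d 1, ?_, ?_⟩
      · simp [e, coeff_monomial, hne]
      · simp [hx]
    · refine ⟨Finsupp.single c 1 + Finsupp.single d 1, ?_, ?_⟩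
      · simp [e, coeff_monomial, hne]
      · simp [hx]

theorem vars_eq_of_associated {σ K : Type*} [Field K] {f g : MvPolynomial σ K}
    (h : Associated f g) : f.vars = g.vars := by
  obtain ⟨u, rfl⟩ := h
  obtain ⟨c, hc, hu⟩ := (isUnit_iff_eq_C_of_isReduced).1 u.isUnit
  rw [hu, mul_comm, vars_C_mul _ hc.ne_zero]

theorem span_eq_radical_of_squarefree {R : Type*} [CommRing R] [IsDomain R]
    [UniqueFactorizationMonoid R] {r d : R} {N : ℕ} (hr : Squarefree r) (h1 : r ∣ d)
    (h2 : d ∣ r ^ N) : Ideal.span {r} = (Ideal.span {d}).radical := by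
  apply le_antisymm
  · rw [Ideal.span_singleton_le_iff_mem]
    exact ⟨N, Ideal.mem_span_singleton.2 h2⟩
  · have : (Ideal.span {r}).IsRadical := isRadical_iff_span_singleton.1 hr.isRadical
    rw [this.radical_le_iff]
    exact Ideal.span_singleton_le_span_singleton.2 h1

end Minor

section Run
variable {n : ℕ}

theorem pickCW_eq_some {S : Finset (Prp n)} {v : ZMod n} {p : Prp n}
    (h : pickCW n S v = some p) : p ∈ S ∧ v ∈ supp n p ∧
      ∀ q ∈ S, v ∈ supp n q → cwKey n v q ≤ cwKey n v p := by
  unfold pickCW at h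
  split_ifs at h with hne
  have hs := Classical.choose_spec
    ((S.filter fun p => v ∈ supp n p).exists_max_image (cwKey n v) hne)
  rw [Option.some_inj.1 h] at hs
  simpa [and_assoc] using hs

theorem pickCW_eq_none {S : Finset (Prp n)} {v : ZMod n}
    (h : pickCW n S v = none) : ∀ q ∈ S, v ∉ supp n q := by
  unfold pickCW at h
  split_ifs at h with hne
  intro q hq hv
  exact hne ⟨q, Finset.mem_filter.2 ⟨hq, hv⟩⟩

/-- The propagator deleted at step `t` of the run started at `s`. -/
noncomputable def pickAt (P : Finset (Prp n)) (s : ZMod n) (t : ℕ) : Option (Prp n) :=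
  pickCW n (gnRun n P s t).1 (s + (t : ZMod n))

theorem mem_gnRun_succ (P : Finset (Prp n)) (s : ZMod n) (t : ℕ) (q : Prp n) :
    q ∈ (gnRun n P s (t + 1)).1 ↔ q ∈ (gnRun n P s t).1 ∧ pickAt P s t ≠ some q := by
  rw [pickAt, gnRun]
  cases h : pickCW n (gnRun n P s t).1 (s + (t : ZMod n)) with
  | none => simp
  | some p => simp [and_comm, eq_comm]

theorem gnRun_succ_snd (P : Finset (Prp n)) (s : ZMod n) (t : ℕ) (q : Prp n) :
    (gnRun n P s (t + 1)).2 q =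
      if pickAt P s t = some q then some (s + (t : ZMod n)) else (gnRun n P s t).2 q := by
  rw [pickAt, gnRun]
  cases h : pickCW n (gnRun n P s t).1 (s + (t : ZMod n)) with
  | none => simp
  | some p => simp [Function.update_apply, eq_comm]

theorem mem_gnRun (P : Finset (Prp n)) (s : ZMod n) (t : ℕ) (q : Prp n) :
    q ∈ (gnRun n P s t).1 ↔ q ∈ P ∧ ∀ u < t, pickAt P s u ≠ some q := by
  induction t with
  | zero => simp [gnRun]
  | succ t ih =>
    rw [mem_gnRun_succ, ih, and_assoc]
    simp only [Nat.lt_succ_iff_lt_or_eq, or_imp, forall_and, forall_eq]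

theorem pickAt_inj {P : Finset (Prp n)} {s : ZMod n} {t u : ℕ} {q : Prp n}
    (ht : pickAt P s t = some q) (hu : pickAt P s u = some q) : t = u := by
  have h1 := ((mem_gnRun P s t q).1 (pickCW_eq_some ht).1).2 u
  have h2 := ((mem_gnRun P s u q).1 (pickCW_eq_some hu).1).2 t
  by_contra hne
  rcases lt_or_gt_of_ne hne with h | h
  · exact h2 h ht
  · exact h1 h hu

theorem gnRun_snd_eq_some (P : Finset (Prp n)) (s : ZMod n) (t : ℕ) (q : Prp n) (v : ZMod n) :
    (gnRun n P s t).2 q = some v ↔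
      ∃ u < t, pickAt P s u = some q ∧ v = s + (u : ZMod n) := by
  induction t with
  | zero => simp [gnRun]
  | succ t ih =>
    rw [gnRun_succ_snd]
    split_ifs with h
    · constructor
      · intro hv
        exact ⟨t, t.lt_succ_self, h, (Option.some_inj.1 hv).symm⟩
      · rintro ⟨u, -, hu, rfl⟩
        rw [pickAt_inj h hu]
    · rw [ih]
      constructor
      · rintro ⟨u, hu, h'⟩
        exact ⟨u, hu.trans t.lt_succ_self, h'⟩
      · rintro ⟨u, hu, h1, h2⟩
        refine ⟨u, lt_of_le_of_ne (Nat.lt_succ_iff.1 hu) ?_, h1, h2⟩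
        rintro rfl
        exact h h1

theorem ord_add {t : ℕ} (s : ZMod n) (ht : t < n) : ord n s (s + (t : ZMod n)) = t := by
  simp [ord, ZMod.val_natCast, Nat.mod_eq_of_lt ht]

/-- The step at which `p` is deleted, with the value `n` if it never is. -/
noncomputable def gnTime (P : Finset (Prp n)) (s : ZMod n) (p : Prp n) : ℕ :=
  (gnAssign n P s p).elim n (ord n s)

theorem gnTime_eq_iff (P : Finset (Prp n)) (s : ZMod n) (p : Prp n) {t : ℕ} (ht : t < n) :
    gnTime P s p = t ↔ pickAt P s t = some p := by
  constructor
  · intro h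
    unfold gnTime at h
    cases hv : gnAssign n P s p with
    | none =>
      rw [hv] at h
      simp at h
      omega
    | some v =>
      rw [hv] at h
      obtain ⟨u, hu, h1, rfl⟩ := (gnRun_snd_eq_some P s n p v).1 hv
      simp only [Option.elim_some, ord_add s hu] at h
      rwa [← h]
  · intro h
    have : gnAssign n P s p = some (s + (t : ZMod n)) :=
      (gnRun_snd_eq_some P s n p _).2 ⟨t, ht, h, rfl⟩
    rw [gnTime, this, Option.elim_some, ord_add s ht]

theorem gnAssign_eq_of_gnTime_lt {P : Finset (Prp n)} {s : ZMod n} {p : Prp n}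
    (h : gnTime P s p < n) : gnAssign n P s p = some (s + (gnTime P s p : ZMod n)) :=
  (gnRun_snd_eq_some P s n p _).2 ⟨_, h, (gnTime_eq_iff P s p h).1 rfl, rfl⟩

theorem gnTime_inj {P : Finset (Prp n)} {s : ZMod n} {p q : Prp n}
    (h : gnTime P s p < n) (he : gnTime P s p = gnTime P s q) : p = q := by
  have h1 := (gnTime_eq_iff P s p h).1 rfl
  have h2 := (gnTime_eq_iff P s q h).1 he.symm
  exact Option.some_inj.1 (h1.symm.trans h2)

theorem mem_of_gnTime_lt {P : Finset (Prp n)} {s : ZMod n} {p : Prp n}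
    (h : gnTime P s p < n) : p ∈ P ∧ s + (gnTime P s p : ZMod n) ∈ supp n p := by
  have h1 := pickCW_eq_some ((gnTime_eq_iff P s p h).1 rfl)
  exact ⟨((mem_gnRun _ _ _ _).1 h1.1).1, h1.2.1⟩

theorem exists_cwKey_le {P : Finset (Prp n)} {s : ZMod n} {p : Prp n} {t : ℕ} (hp : p ∈ P)
    (ht : t < n) (hs : s + (t : ZMod n) ∈ supp n p) (hlt : t < gnTime P s p) :
    ∃ q, gnTime P s q = t ∧ cwKey n (s + (t : ZMod n)) p ≤ cwKey n (s + (t : ZMod n)) q := by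
  have hmem : p ∈ (gnRun n P s t).1 := by
    rw [mem_gnRun]
    refine ⟨hp, fun u hu h => ?_⟩
    have := (gnTime_eq_iff P s p (hu.trans ht)).2 h
    omega
  cases h : pickAt P s t with
  | none => exact absurd hs (pickCW_eq_none h p hmem)
  | some q => exact ⟨q, (gnTime_eq_iff P s q ht).2 h, (pickCW_eq_some h).2.2 p hmem hs⟩

variable [NeZero n]

theorem ord_lt (s v : ZMod n) : ord n s v < n := ZMod.val_lt _

theorem add_ord (s v : ZMod n) : s + (ord n s v : ZMod n) = v := by
  simp [ord]

end Run

section Linear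
variable {n : ℕ}

/-- The position of the first end of `p` in the linear order starting at `s - 1`. -/
def lo (s : ZMod n) (p : Prp n) : ℕ :=
  Sym2.lift ⟨fun e f => min (ord n (s - 1) e) (ord n (s - 1) f), fun _ _ => min_comm _ _⟩ p

/-- The position of the last end of `p` in the linear order starting at `s - 1`. -/
def hi (s : ZMod n) (p : Prp n) : ℕ :=
  Sym2.lift ⟨fun e f => max (ord n (s - 1) e) (ord n (s - 1) f), fun _ _ => max_comm _ _⟩ p

theorem lo_le_hi (s : ZMod n) (p : Prp n) : lo s p ≤ hi s p := by
  induction p using Sym2.ind with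
  | _ e f => exact min_le_max

theorem add_cast_eq (s : ZMod n) (t : ℕ) :
    s + (t : ZMod n) = s - 1 + ((t + 1 : ℕ) : ZMod n) := by
  push_cast
  ring

theorem mem_supp_iff (p : Prp n) (v : ZMod n) : v ∈ supp n p ↔ v ∈ p ∨ v - 1 ∈ p := by
  induction p using Sym2.ind with
  | _ e f =>
    simp only [supp, Sym2.lift_mk, Finset.mem_insert, Finset.mem_singleton, Sym2.mem_iff,
      sub_eq_iff_eq_add]
    tauto

theorem otherEnd_mk (e f : ZMod n) : otherEnd n s(e, f) e = f := by
  have h : e ∈ s(e, f) := Sym2.mem_mk_left e f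
  rw [otherEnd, dif_pos h]
  exact Sym2.congr_right.1 (Sym2.other_spec h)

theorem lo_hi_mk (s : ZMod n) {x y : ℕ} (hxy : x ≤ y) (hy : y < n) :
    lo s s(s - 1 + (x : ZMod n), s - 1 + (y : ZMod n)) = x ∧
      hi s s(s - 1 + (x : ZMod n), s - 1 + (y : ZMod n)) = y := by
  simp only [lo, hi, Sym2.lift_mk, ord_add (s - 1) hy, ord_add (s - 1) (hxy.trans_lt hy)]
  exact ⟨min_eq_left hxy, max_eq_right hxy⟩

theorem add_cast_inj (s : ZMod n) {x y : ℕ} (hx : x < n) (hy : y < n) :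
    s + (x : ZMod n) = s + (y : ZMod n) ↔ x = y := by
  constructor
  · intro h
    rw [← ord_add s hx, h, ord_add s hy]
  · rintro rfl
    rfl

theorem ord_add_add (s : ZMod n) {x y : ℕ} (hx : x < n) (hy : y < n) :
    ord n (s + (x : ZMod n)) (s + (y : ZMod n)) = if x ≤ y then y - x else y + n - x := by
  have key : ∀ z : ℕ, z < n → (z : ZMod n) = (y : ZMod n) - x →
      ord n (s + (x : ZMod n)) (s + (y : ZMod n)) = z := by
    intro z hz h
    rw [← ord_add (s + (x : ZMod n)) hz, h]
    congr 1
    ring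
  split_ifs with h
  · apply key _ (by omega)
    push_cast [h]
    ring
  · apply key _ (by omega)
    rw [Nat.cast_sub (by omega)]
    simp

theorem succ_notMem {P : Finset (Prp n)} (hadm : IsAdmissible n P) {p : Prp n} (hp : p ∈ P)
    {e : ZMod n} (he : e ∈ p) : p ≠ s(e, e) ∧ e + 1 ∉ p := by
  have h := hadm.dense {p} (by simpa using hp) (by simp)
  simp only [suppSet, Finset.singleton_biUnion, Finset.card_singleton] at h
  constructor
  · rintro rfl
    have : supp n s(e, e) = {e, e + 1} := by
      ext x
      simp [supp]
    have h2 := Finset.card_le_two (a := e) (b := e + 1)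
    rw [this] at h
    omega
  · intro h1
    have hne : e ≠ e + 1 := by
      have hn : 1 < n := by have := hadm.card_add_four_le; omega
      have : Fact (1 < n) := ⟨hn⟩
      simp
    obtain rfl : p = s(e, e + 1) := ((Sym2.mem_and_mem_iff hne).1 ⟨he, h1⟩)
    have h2 : supp n s(e, e + 1) = {e, e + 1, e + 1 + 1} := by
      ext x
      simp [supp]
    have := Finset.card_le_three (a := e) (b := e + 1) (c := e + 1 + 1)
    rw [h2] at h
    omega

variable [NeZero n]

theorem eq_mk_lo_hi (s : ZMod n) (p : Prp n) :
    p = s(s - 1 + (lo s p : ZMod n), s - 1 + (hi s p : ZMod n)) := by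
  induction p using Sym2.ind with
  | _ e f =>
    simp only [lo, hi, Sym2.lift_mk]
    rcases le_total (ord n (s - 1) e) (ord n (s - 1) f) with h | h
    · rw [min_eq_left h, max_eq_right h, add_ord, add_ord]
    · rw [min_eq_right h, max_eq_left h, add_ord, add_ord, Sym2.eq_swap]

theorem hi_lt (s : ZMod n) (p : Prp n) : hi s p < n := by
  induction p using Sym2.ind with
  | _ e f => exact max_lt (ord_lt _ _) (ord_lt _ _)

theorem mem_iff_lo_hi (s : ZMod n) (p : Prp n) {t : ℕ} (ht : t < n) :
    s - 1 + (t : ZMod n) ∈ p ↔ t = lo s p ∨ t = hi s p := by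
  conv_lhs => rw [eq_mk_lo_hi s p]
  have := hi_lt s p
  have := lo_le_hi s p
  rw [Sym2.mem_iff, add_cast_inj _ ht (by omega), add_cast_inj _ ht (by omega)]

theorem mem_supp_iff_meets (s : ZMod n) (p : Prp n) {t : ℕ} (ht : t + 1 < n) :
    s + (t : ZMod n) ∈ supp n p ↔ Meets t (lo s p) (hi s p) := by
  rw [mem_supp_iff, show s + (t : ZMod n) - 1 = s - 1 + (t : ZMod n) by ring,
    mem_iff_lo_hi s p (by omega), add_cast_eq, mem_iff_lo_hi s p ht]
  unfold Meets
  tauto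

theorem otherEnd_lo (s : ZMod n) (p : Prp n) :
    otherEnd n p (s - 1 + (lo s p : ZMod n)) = s - 1 + (hi s p : ZMod n) := by
  conv_lhs => enter [2]; rw [eq_mk_lo_hi s p]
  exact otherEnd_mk _ _

theorem otherEnd_hi (s : ZMod n) (p : Prp n) :
    otherEnd n p (s - 1 + (hi s p : ZMod n)) = s - 1 + (lo s p : ZMod n) := by
  conv_lhs => enter [2]; rw [eq_mk_lo_hi s p, Sym2.eq_swap]
  exact otherEnd_mk _ _

theorem ord_otherEnd (s : ZMod n) (p : Prp n) (hlt : lo s p < hi s p) {t : ℕ} (ht : t < n)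
    (h : t = lo s p ∨ t = hi s p) :
    ord n (s - 1 + (t : ZMod n)) (otherEnd n p (s - 1 + (t : ZMod n))) =
      if t = lo s p then hi s p - lo s p else lo s p + n - hi s p := by
  have := hi_lt s p
  rcases h with rfl | rfl
  · rw [otherEnd_lo, ord_add_add _ ht (by omega), if_pos rfl, if_pos (by omega)]
  · rw [otherEnd_hi, ord_add_add _ ht (by omega), if_neg (by omega), if_neg (by omega)]

theorem cwKey_eq_linKey (s : ZMod n) (p : Prp n) (hlt : lo s p < hi s p) {t : ℕ}
    (ht : t + 1 < n) (h : Meets t (lo s p) (hi s p)) :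
    cwKey n (s + (t : ZMod n)) p = linKey n t (lo s p) (hi s p) := by
  rw [cwKey, show s + (t : ZMod n) - 1 = s - 1 + (t : ZMod n) by ring, add_cast_eq s t]
  unfold Meets at h
  split_ifs with h1
  · rw [mem_iff_lo_hi s p (by omega)] at h1
    rw [ord_otherEnd s p hlt (by omega) h1]
    unfold linKey
    split_ifs <;> omega
  · rw [mem_iff_lo_hi s p (by omega)] at h1
    rw [ord_otherEnd s p hlt (by omega) (by omega)]
    unfold linKey
    split_ifs <;> omega

theorem linKey_inj {n t k a k' a' : ℕ} (h1 : k + 2 ≤ a) (h2 : a < n) (h1' : k' + 2 ≤ a')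
    (h2' : a' < n) (hm : Meets t k a) (hm' : Meets t k' a')
    (h : linKey n t k a = linKey n t k' a') : k = k' ∧ a = a' := by
  unfold linKey at h
  unfold Meets at hm hm'
  split_ifs at h <;> omega

theorem lo_add_two_le {P : Finset (Prp n)} (hadm : IsAdmissible n P) {p : Prp n} (hp : p ∈ P)
    (s : ZMod n) : lo s p + 2 ≤ hi s p := by
  have h1 := lo_le_hi s p
  have h2 := hi_lt s p
  have h3 := succ_notMem hadm hp ((mem_iff_lo_hi s p (t := lo s p) (by omega)).2 (Or.inl rfl))
  by_contra hc
  rcases (show hi s p = lo s p ∨ hi s p = lo s p + 1 by omega) with h | h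
  · apply h3.1
    conv_lhs => rw [eq_mk_lo_hi s p, h]
  · apply h3.2
    rw [show s - 1 + (lo s p : ZMod n) + 1 = s - 1 + ((lo s p + 1 : ℕ) : ZMod n) by
      push_cast; ring, mem_iff_lo_hi s p (by omega)]
    omega

theorem exists_cwKey_lt {P : Finset (Prp n)} (hadm : IsAdmissible n P) {s : ZMod n} {p : Prp n}
    {t : ℕ} (hp : p ∈ P) (ht : t + 1 < n) (hs : s + (t : ZMod n) ∈ supp n p)
    (hlt : t < gnTime P s p) :
    ∃ q ∈ P, gnTime P s q = t ∧
      cwKey n (s + (t : ZMod n)) p < cwKey n (s + (t : ZMod n)) q := by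
  obtain ⟨q, hq, hk⟩ := exists_cwKey_le hp (by omega) hs hlt
  obtain ⟨hqP, hqs⟩ := mem_of_gnTime_lt (P := P) (s := s) (p := q) (by omega)
  refine ⟨q, hqP, hq, lt_of_le_of_ne hk fun he => ?_⟩
  rw [hq] at hqs
  have h1 := lo_add_two_le hadm hp s
  have h2 := lo_add_two_le hadm hqP s
  rw [mem_supp_iff_meets s _ ht] at hs hqs
  rw [cwKey_eq_linKey s p (by omega) ht hs, cwKey_eq_linKey s q (by omega) ht hqs] at he
  have h3 := linKey_inj h1 (hi_lt s p) h2 (hi_lt s q) hs hqs he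
  have : p = q := by
    rw [eq_mk_lo_hi s p, h3.1, h3.2, ← eq_mk_lo_hi s q]
  subst this
  omega

theorem linModel {P : Finset (Prp n)} (hadm : IsAdmissible n P) (s : ZMod n) :
    LinModel P n (fun p => lo s p) (fun p => hi s p) (fun p => gnTime P s p) where
  gap p := lo_add_two_le hadm p.2 s
  lt p := hi_lt s p
  inj p q h1 h2 := by
    apply Subtype.ext
    rw [eq_mk_lo_hi s p, h1, h2, ← eq_mk_lo_hi s q]
  noncross p q h1 h2 := by
    by_contra hc
    have := hi_lt s p
    have := hi_lt s q
    refine hadm.noncross p p.2 q q.2 ⟨_, _, _, _, eq_mk_lo_hi s p, eq_mk_lo_hi s q, ?_⟩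
    rw [ord_add_add _ (by omega) (by omega), ord_add_add _ (by omega) (by omega),
      ord_add_add _ (by omega) (by omega)]
    split_ifs <;> omega
  meets p h := (mem_supp_iff_meets s _ h).1 (mem_of_gnTime_lt (by omega)).2
  T_inj p q h he := Subtype.ext (gnTime_inj (by omega) he)
  greedy p t ht hm hlt := by
    have hs := (mem_supp_iff_meets s p ht).2 hm
    obtain ⟨q, hq, hqt, hk⟩ := exists_cwKey_lt hadm p.2 ht hs hlt
    refine ⟨⟨q, hq⟩, hqt, ?_⟩
    have hqs := (mem_of_gnTime_lt (P := P) (s := s) (p := q) (by omega)).2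
    rw [hqt, mem_supp_iff_meets s _ ht] at hqs
    have h1 := lo_add_two_le hadm p.2 s
    have h2 := lo_add_two_le hadm hq s
    rwa [cwKey_eq_linKey s p (by omega) ht hm, cwKey_eq_linKey s q (by omega) ht hqs] at hk

end Linear

section Necklace
variable {n : ℕ} {P : Finset (Prp n)} {p q : Prp n}

/-- The necklace term started at `s` assigns the two ends of a common edge to `p` and `q`. -/
def Mate (P : Finset (Prp n)) (s : ZMod n) (p q : Prp n) : Prop :=
  ∃ a, a ∈ p ∧ a ∈ q ∧ gnAssign n P s p = some a ∧ gnAssign n P s q = some (a + 1)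

theorem not_mate_mate (hadm : IsAdmissible n P) {r : Prp n} {s : ZMod n} (hq : q ∈ P)
    (h : Mate P s p q) : ¬ Mate P s q r := by
  obtain ⟨a, -, h0, h1, h2⟩ := h
  rintro ⟨b, h5, -, h3, h4⟩
  obtain rfl : a + 1 = b := Option.some_inj.1 (h2.symm.trans h3)
  exact (succ_notMem hadm hq h0).2 h5

variable [NeZero n]

theorem gnTime_lt_hi (hadm : IsAdmissible n P) (hp : p ∈ P) (s : ZMod n) :
    gnTime P s p < hi s p :=
  (linModel hadm s).T_lt ⟨p, hp⟩

theorem gnTime_add_one_lt (hadm : IsAdmissible n P) (hp : p ∈ P) (s : ZMod n) :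
    gnTime P s p + 1 < n := by
  have := gnTime_lt_hi hadm hp s
  have := hi_lt s p
  omega

theorem gnTime_cases (hadm : IsAdmissible n P) (hp : p ∈ P) (s : ZMod n) :
    gnTime P s p = lo s p ∨ gnTime P s p + 1 = lo s p ∨ gnTime P s p + 1 = hi s p :=
  (linModel hadm s).T_cases ⟨p, hp⟩

theorem gnAssign_eq (hadm : IsAdmissible n P) (hp : p ∈ P) (s : ZMod n) :
    gnAssign n P s p = some (s + (gnTime P s p : ZMod n)) :=
  gnAssign_eq_of_gnTime_lt (by have := gnTime_add_one_lt hadm hp s; omega)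

theorem gnAssign_eq_some_iff (hadm : IsAdmissible n P) (hp : p ∈ P) (s : ZMod n) {t : ℕ}
    (ht : t < n) : gnAssign n P s p = some (s + (t : ZMod n)) ↔ gnTime P s p = t := by
  rw [gnAssign_eq hadm hp, Option.some_inj,
    add_cast_inj s (by have := gnTime_add_one_lt hadm hp s; omega) ht]

theorem colOf_eq (hadm : IsAdmissible n P) (hp : p ∈ P) (s : ZMod n) :
    colOf n P s p = s + (gnTime P s p : ZMod n) := by
  rw [colOf, gnAssign_eq hadm hp, Option.getD_some]

theorem gnAssign_eq_colOf (hadm : IsAdmissible n P) (hp : p ∈ P) (s : ZMod n) :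
    gnAssign n P s p = some (colOf n P s p) := by
  rw [colOf_eq hadm hp, gnAssign_eq hadm hp]

theorem colOf_mem_supp (hadm : IsAdmissible n P) (hp : p ∈ P) (s : ZMod n) :
    colOf n P s p ∈ supp n p := by
  rw [colOf_eq hadm hp]
  exact (mem_of_gnTime_lt (by have := gnTime_add_one_lt hadm hp s; omega)).2

theorem eq_of_gnAssign_eq (hadm : IsAdmissible n P) {s v : ZMod n} (hp : p ∈ P) (hq : q ∈ P)
    (h1 : gnAssign n P s p = some v) (h2 : gnAssign n P s q = some v) : p = q := by
  rw [← h2, gnAssign_eq hadm hq, gnAssign_eq_some_iff hadm hp s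
    (by have := gnTime_add_one_lt hadm hq s; omega)] at h1
  exact gnTime_inj (by have := gnTime_add_one_lt hadm hp s; omega) h1

theorem mate_iff (hadm : IsAdmissible n P) (hp : p ∈ P) (hq : q ∈ P) (s : ZMod n) :
    Mate P s p q ↔ gnTime P s q = gnTime P s p + 1 ∧
      (gnTime P s q = lo s p ∨ gnTime P s q = hi s p) ∧
      (gnTime P s q = lo s q ∨ gnTime P s q = hi s q) := by
  have h1 := gnTime_add_one_lt hadm hp s
  have h2 := gnTime_add_one_lt hadm hq s
  have key : s + (gnTime P s p : ZMod n) + 1 = s + ((gnTime P s p + 1 : ℕ) : ZMod n) := by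
    push_cast
    ring
  have key2 : s + (gnTime P s p : ZMod n) = s - 1 + ((gnTime P s p + 1 : ℕ) : ZMod n) :=
    add_cast_eq _ _
  constructor
  · rintro ⟨a, ha, hb, hpa, hqa⟩
    rw [gnAssign_eq hadm hp, Option.some_inj] at hpa
    subst hpa
    rw [key, gnAssign_eq_some_iff hadm hq s h1] at hqa
    rw [key2, mem_iff_lo_hi s _ h1] at ha hb
    rw [hqa]
    exact ⟨rfl, ha, hb⟩
  · rintro ⟨h, ha, hb⟩
    rw [h] at ha hb
    refine ⟨s + (gnTime P s p : ZMod n), ?_, ?_, gnAssign_eq hadm hp s, ?_⟩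
    · rwa [key2, mem_iff_lo_hi s _ h1]
    · rwa [key2, mem_iff_lo_hi s _ h1]
    · rwa [key, gnAssign_eq_some_iff hadm hq s h1]

theorem mate_right_unique (hadm : IsAdmissible n P) {r : Prp n} {s : ZMod n} (hq : q ∈ P)
    (hr : r ∈ P) (h : Mate P s p q) (h' : Mate P s p r) : r = q := by
  obtain ⟨a, -, -, h1, h2⟩ := h
  obtain ⟨b, -, -, h3, h4⟩ := h'
  obtain rfl : a = b := Option.some_inj.1 (h1.symm.trans h3)
  exact eq_of_gnAssign_eq hadm hr hq h4 h2

theorem mate_cwKey_lt (hadm : IsAdmissible n P) {s a : ZMod n} (hp : p ∈ P) (hq : q ∈ P)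
    (hap : a ∈ p) (haq : a ∈ q) (h1 : gnAssign n P s p = some a)
    (h2 : gnAssign n P s q = some (a + 1)) : cwKey n a q < cwKey n a p := by
  have h := ((mate_iff hadm hp hq s).1 ⟨a, hap, haq, h1, h2⟩).1
  have h3 := gnTime_add_one_lt hadm hp s
  rw [gnAssign_eq hadm hp, Option.some_inj] at h1
  subst h1
  obtain ⟨r, hr, hrt, hk⟩ := exists_cwKey_lt hadm hq h3
    ((mem_supp_iff _ _).2 (Or.inl haq)) (by omega)
  rwa [gnTime_inj (by omega) hrt] at hk

theorem gnTime_le (hadm : IsAdmissible n P) (s : ZMod n) (hp : p ∈ P) :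
    gnTime P s p ≤ gnTime P (s + 1) p + 1 := by
  suffices H : ∀ m, ∀ p ∈ P, gnTime P (s + 1) p = m → gnTime P s p ≤ m + 1 from H _ p hp rfl
  intro m
  induction m using Nat.strong_induction_on with
  | _ m ih =>
    rintro p hp rfl
    by_contra hc
    have h1 := gnTime_add_one_lt hadm hp s
    have h2 := gnTime_add_one_lt hadm hp (s + 1)
    have hv : s + ((gnTime P (s + 1) p + 1 : ℕ) : ZMod n) =
        s + 1 + (gnTime P (s + 1) p : ZMod n) := by
      push_cast
      ring
    have hs := (mem_of_gnTime_lt (P := P) (s := s + 1) (p := p) (by omega)).2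
    obtain ⟨q, hq, hqt, hk⟩ := exists_cwKey_lt (s := s) (t := gnTime P (s + 1) p + 1) hadm hp
      (by omega) (by rwa [hv]) (by omega)
    have hqs := (mem_of_gnTime_lt (P := P) (s := s) (p := q) (by omega)).2
    rw [hqt, hv] at hqs
    rw [hv] at hk
    rcases lt_trichotomy (gnTime P (s + 1) q) (gnTime P (s + 1) p) with h | h | h
    · have := ih _ h q hq rfl
      omega
    · obtain rfl := gnTime_inj (by omega) h.symm
      omega
    · obtain ⟨r, hr, hrt, hk'⟩ := exists_cwKey_lt hadm hq h2 hqs h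
      obtain rfl := gnTime_inj (by omega) hrt.symm
      omega

theorem gnAssign_succ_iff (hadm : IsAdmissible n P) (s : ZMod n) (hp : p ∈ P) :
    gnAssign n P s p = gnAssign n P (s + 1) p ↔ gnTime P s p = gnTime P (s + 1) p + 1 := by
  rw [gnAssign_eq hadm hp (s + 1), show s + 1 + (gnTime P (s + 1) p : ZMod n) =
      s + ((gnTime P (s + 1) p + 1 : ℕ) : ZMod n) by push_cast; ring,
    gnAssign_eq_some_iff hadm hp s (gnTime_add_one_lt hadm hp _)]

theorem lo_hi_succ (hadm : IsAdmissible n P) (s : ZMod n) (hp : p ∈ P) :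
    (hi (s + 1) p + 1 < n ∧ lo s p = lo (s + 1) p + 1 ∧ hi s p = hi (s + 1) p + 1) ∨
      (hi (s + 1) p + 1 = n ∧ lo s p = 0 ∧ hi s p = lo (s + 1) p + 1) := by
  have h1 := hi_lt (s + 1) p
  have h2 := lo_add_two_le hadm hp (s + 1)
  have h3 : ∀ t : ℕ, s + 1 - 1 + (t : ZMod n) = s - 1 + ((t + 1 : ℕ) : ZMod n) := by
    intro t
    push_cast
    ring
  have h4 := eq_mk_lo_hi (s + 1) p
  rw [h3, h3] at h4
  rcases (show hi (s + 1) p + 1 < n ∨ hi (s + 1) p + 1 = n by omega) with h | h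
  · left
    have := lo_hi_mk s (x := lo (s + 1) p + 1) (y := hi (s + 1) p + 1) (by omega) h
    rw [← h4] at this
    exact ⟨h, this⟩
  · right
    have := lo_hi_mk s (x := 0) (y := lo (s + 1) p + 1) (by omega) (by omega)
    rw [h, ZMod.natCast_self, Sym2.eq_swap] at h4
    rw [Nat.cast_zero, ← h4] at this
    exact ⟨h, this⟩

theorem Mate.gnAssign_succ_left (hadm : IsAdmissible n P) {s : ZMod n} (hp : p ∈ P) (hq : q ∈ P)
    (hm : Mate P (s + 1) p q) (h : gnAssign n P s q = gnAssign n P (s + 1) q) :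
    gnAssign n P s p = gnAssign n P (s + 1) p := by
  by_contra hne
  obtain ⟨a, hap, haq, hpa, hqa⟩ := id hm
  obtain ⟨hm1, hm2, hm3⟩ := (mate_iff hadm hp hq _).1 hm
  have hk := mate_cwKey_lt hadm hp hq hap haq hpa hqa
  rw [gnAssign_succ_iff hadm s hq] at h
  rw [gnAssign_succ_iff hadm s hp] at hne
  have h1 := gnTime_le hadm s hp
  have h2 := gnTime_add_one_lt hadm hq s
  have h3 := gnTime_add_one_lt hadm hq (s + 1)
  have hva : s + 1 + (gnTime P (s + 1) p : ZMod n) = a :=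
    Option.some_inj.1 ((gnAssign_eq hadm hp _).symm.trans hpa)
  have hvb : s + 1 + (gnTime P (s + 1) q : ZMod n) = a + 1 :=
    Option.some_inj.1 ((gnAssign_eq hadm hq _).symm.trans hqa)
  have hvX : s + ((gnTime P (s + 1) p + 1 : ℕ) : ZMod n) = a := by
    rw [← hva]
    push_cast
    ring
  obtain ⟨x, hx, hxt, hxk⟩ := exists_cwKey_lt (s := s) (t := gnTime P (s + 1) p + 1) hadm hq
    (by omega) (by rw [hvX]; exact (mem_supp_iff _ _).2 (Or.inl haq)) (by omega)
  have hxs := (mem_of_gnTime_lt (P := P) (s := s) (p := x) (by omega)).2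
  rw [hxt, hvX] at hxs
  rw [hvX] at hxk
  have h4 := gnTime_le hadm s hx
  have hxp : gnTime P (s + 1) x ≠ gnTime P (s + 1) p := by
    intro hh
    obtain rfl := gnTime_inj (by omega) hh
    omega
  have hxq : gnTime P (s + 1) x ≠ gnTime P (s + 1) q := by
    intro hh
    obtain rfl := gnTime_inj (by omega) hh
    omega
  have hkp : cwKey n a x < cwKey n a p := by
    obtain ⟨r, hr, hrt, hk'⟩ := exists_cwKey_lt (s := s + 1) (t := gnTime P (s + 1) p) hadm hx
      (by omega) (by rwa [hva]) (by omega)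
    obtain rfl := gnTime_inj (by omega) hrt
    rwa [hva] at hk'
  have hnot : ∀ y ∈ P, a ∈ y → a - 1 ∉ y := by
    intro y hy hay hay'
    exact (succ_notMem hadm hy hay').2 (by simpa using hay)
  have hxa : a ∈ x := by
    rcases (mem_supp_iff _ _).1 hxs with h | h
    · exact h
    · simp only [cwKey, if_neg (hnot p hp hap), if_pos h] at hkp
      have := ord_lt a (otherEnd n p a)
      omega
  obtain ⟨r, hr, hrt, hk'⟩ := exists_cwKey_lt (s := s + 1) (t := gnTime P (s + 1) q) hadm hx
    (by omega) (by rw [hvb]; exact (mem_supp_iff _ _).2 (Or.inr (by simpa using hxa)))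
    (by omega)
  obtain rfl := gnTime_inj (by omega) hrt
  rw [hvb] at hk'
  simp only [cwKey, add_sub_cancel_right, if_pos haq, if_pos hxa] at hk'
  simp only [cwKey, if_neg (hnot _ hr haq), if_neg (hnot _ hx hxa)] at hxk
  omega

theorem Mate.gnAssign_succ_right (hadm : IsAdmissible n P) {s : ZMod n} (hp : p ∈ P) (hq : q ∈ P)
    (hm : Mate P (s + 1) p q) (h : gnAssign n P s p = gnAssign n P (s + 1) p) :
    gnAssign n P s q = gnAssign n P (s + 1) q := by
  by_contra hne
  obtain ⟨a, hap, haq, hpa, hqa⟩ := id hm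
  obtain ⟨hm1, hm2, hm3⟩ := (mate_iff hadm hp hq _).1 hm
  have hk := mate_cwKey_lt hadm hp hq hap haq hpa hqa
  rw [gnAssign_succ_iff hadm s hp] at h
  rw [gnAssign_succ_iff hadm s hq] at hne
  have h1 := gnTime_le hadm s hq
  have h2 := gnTime_add_one_lt hadm hp s
  have h3 := gnTime_add_one_lt hadm hp (s + 1)
  have hpq : p ≠ q := by
    rintro rfl
    omega
  have hT : gnTime P s q ≠ gnTime P s p := fun hh =>
    hpq (gnTime_inj (by omega) hh.symm)
  have hlq := gnTime_lt_hi hadm hq (s + 1)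
  have hcq := gnTime_cases hadm hq s
  have hgq := lo_add_two_le hadm hq (s + 1)
  have hgp := lo_add_two_le hadm hp (s + 1)
  have hhp := hi_lt (s + 1) p
  have hhq := hi_lt (s + 1) q
  have hva : s + 1 + (gnTime P (s + 1) p : ZMod n) = a :=
    Option.some_inj.1 ((gnAssign_eq hadm hp _).symm.trans hpa)
  rw [← hva, cwKey_eq_linKey (s + 1) q (by omega) h3 (by unfold Meets; omega),
    cwKey_eq_linKey (s + 1) p (by omega) h3 (by unfold Meets; omega)] at hk
  have hlo : gnTime P (s + 1) q = lo (s + 1) q := by omega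
  have hsq : hi (s + 1) q + 1 = n ∧ lo s q = 0 ∧ hi s q = lo (s + 1) q + 1 := by
    rcases lo_hi_succ hadm s hq with hs | hs
    · omega
    · exact hs
  have hhi : gnTime P (s + 1) q = hi (s + 1) p := by
    refine hm2.resolve_left fun hl => ?_
    rw [linKey, if_neg (by omega), if_neg (by omega), if_pos (by omega), linKey,
      if_neg (by omega), if_neg (by omega), if_pos (by omega)] at hk
    omega
  have hsp : hi s p = hi (s + 1) p + 1 := by
    rcases lo_hi_succ hadm s hp with hs | hs
    · exact hs.2.2
    · omega
  have hright := (linModel hadm s).le_of_right ⟨p, hp⟩ ⟨q, hq⟩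
  have hinj := (linModel hadm s).inj ⟨p, hp⟩ ⟨q, hq⟩
  simp only [Subtype.mk.injEq] at hright hinj
  have key : hi s p = hi s q ∧ gnTime P s p + 1 = hi s p := by omega
  have := hright key.2 key.1.symm
  exact hpq (hinj (by omega) key.1)

theorem Mate.gnAssign_eq_iff (hadm : IsAdmissible n P) {s : ZMod n} (hp : p ∈ P) (hq : q ∈ P)
    (hm : Mate P (s + 1) p q) : gnAssign n P s p = gnAssign n P (s + 1) p ↔
      gnAssign n P s q = gnAssign n P (s + 1) q :=
  ⟨hm.gnAssign_succ_right hadm hp hq, hm.gnAssign_succ_left hadm hp hq⟩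

end Necklace

section Necklace
variable {n : ℕ} {P : Finset (Prp n)} {p q : Prp n}

theorem mem_of_gnAssign {s v : ZMod n} (h : gnAssign n P s p = some v) : p ∈ P := by
  obtain ⟨u, -, hu, -⟩ := (gnRun_snd_eq_some P s n p v).1 h
  exact ((mem_gnRun _ _ _ _).1 (pickCW_eq_some hu).1).1

theorem Mate.mem_left {s : ZMod n} (h : Mate P s p q) : p ∈ P :=
  h.elim fun _ h => mem_of_gnAssign h.2.2.1

theorem Mate.mem_right {s : ZMod n} (h : Mate P s p q) : q ∈ P :=
  h.elim fun _ h => mem_of_gnAssign h.2.2.2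

theorem cwKey_of_mem (hadm : IsAdmissible n P) (hp : p ∈ P) {a : ZMod n} (ha : a ∈ p) :
    cwKey n a p = ord n a (otherEnd n p a) ∧ cwKey n (a + 1) p = n + ord n a (otherEnd n p a) := by
  constructor
  · rw [cwKey, if_neg fun h => (succ_notMem hadm hp h).2 (by simpa using ha)]
  · simp [cwKey, ha]

variable [NeZero n]

theorem mem_of_cwKey_lt (hadm : IsAdmissible n P) (hp : p ∈ P) {a : ZMod n} (ha : a ∈ p)
    (hk : cwKey n (a + 1) p < cwKey n (a + 1) q) : a ∈ q := by
  rw [(cwKey_of_mem hadm hp ha).2, cwKey] at hk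
  split_ifs at hk with h
  · simpa using h
  · have := ord_lt (a + 1) (otherEnd n q (a + 1))
    omega

theorem Mate.gnAssign_pred_left (hadm : IsAdmissible n P) {s : ZMod n} (hp : p ∈ P) (hq : q ∈ P)
    (hm : Mate P s p q) (h : gnAssign n P s q = gnAssign n P (s + 1) q) :
    gnAssign n P s p = gnAssign n P (s + 1) p := by
  by_contra hne
  obtain ⟨a, hap, haq, hpa, hqa⟩ := id hm
  have hm1 := ((mate_iff hadm hp hq _).1 hm).1
  have hk := mate_cwKey_lt hadm hp hq hap haq hpa hqa
  rw [h] at hqa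
  rw [gnAssign_succ_iff hadm s hq] at h
  rw [gnAssign_succ_iff hadm s hp] at hne
  have h1 := gnTime_le hadm s hp
  have h3 := gnTime_add_one_lt hadm hq (s + 1)
  have hT : gnTime P (s + 1) q ≠ gnTime P (s + 1) p := by
    intro hh
    obtain rfl := gnTime_inj (by omega) hh
    omega
  have hv : s + 1 + (gnTime P (s + 1) q : ZMod n) = a + 1 :=
    Option.some_inj.1 ((gnAssign_eq hadm hq _).symm.trans hqa)
  obtain ⟨r, hr, hrt, hk'⟩ := exists_cwKey_lt hadm hp h3
    (by rw [hv]; exact (mem_supp_iff _ _).2 (Or.inr (by simpa using hap))) (by omega)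
  obtain rfl := gnTime_inj (by omega) hrt
  rw [hv] at hk'
  have := cwKey_of_mem hadm hp hap
  have := cwKey_of_mem hadm hq haq
  omega

theorem Mate.gnAssign_pred_right (hadm : IsAdmissible n P) {s : ZMod n} (hp : p ∈ P) (hq : q ∈ P)
    (hm : Mate P s p q) (h : gnAssign n P s p = gnAssign n P (s + 1) p) :
    gnAssign n P s q = gnAssign n P (s + 1) q := by
  by_contra hne
  obtain ⟨a, hap, haq, hpa, hqa⟩ := id hm
  obtain ⟨hm1, hm2, -⟩ := (mate_iff hadm hp hq _).1 hm
  rw [gnAssign_succ_iff hadm s hp] at h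
  rw [gnAssign_succ_iff hadm s hq] at hne
  have h1 := gnTime_le hadm s hq
  have h2 := gnTime_add_one_lt hadm hq s
  have h3 := gnTime_add_one_lt hadm hp (s + 1)
  obtain rfl : s + (gnTime P s p : ZMod n) = a :=
    Option.some_inj.1 ((gnAssign_eq hadm hp _).symm.trans hpa)
  have hv : s + 1 + (gnTime P (s + 1) p : ZMod n) = s + (gnTime P s p : ZMod n) := by
    rw [h]
    push_cast
    ring
  have hv' : s + 1 + (gnTime P s p : ZMod n) = s + (gnTime P s p : ZMod n) + 1 := by ring
  obtain ⟨r, hr, hrt, hk⟩ := exists_cwKey_lt (s := s + 1) (t := gnTime P s p) hadm hq (by omega)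
    (by rw [hv']; exact (mem_supp_iff _ _).2 (Or.inr (by simpa using haq))) (by omega)
  rw [hv'] at hk
  have har := mem_of_cwKey_lt hadm hq haq hk
  have hpr : p ≠ r := by
    rintro rfl
    omega
  have hqr : q ≠ r := by
    rintro rfl
    omega
  have h4 := gnTime_le hadm s hr
  have h5 : gnTime P s p ≠ gnTime P s r := fun hh => hpr (gnTime_inj (by omega) hh)
  have h6 : gnTime P s q ≠ gnTime P s r := fun hh => hqr (gnTime_inj (by omega) hh)
  have hgr := lo_add_two_le hadm hr s
  have hcr := gnTime_cases hadm hr s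
  rw [add_cast_eq, mem_iff_lo_hi s r (by omega)] at har
  have hhr : hi s r = gnTime P s p + 1 := by omega
  have hlr : lo s r = 0 := by
    have h7 := gnTime_lt_hi hadm hr (s + 1)
    rcases lo_hi_succ hadm s hr with hs | hs
    · omega
    · exact hs.2.1
  obtain ⟨x, hx, hxt, hxk⟩ := exists_cwKey_lt hadm hr h3
    (by rw [hv]; exact (mem_supp_iff _ _).2 (Or.inl (by rwa [add_cast_eq, mem_iff_lo_hi s r (by omega)])))
    (by omega)
  obtain rfl := gnTime_inj (by omega) hxt
  rw [hv, cwKey_eq_linKey s r (by omega) (by omega) (by unfold Meets; omega),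
    cwKey_eq_linKey s x (by have := lo_add_two_le hadm hx s; omega) (by omega)
      (by unfold Meets; omega)] at hxk
  have hgx := lo_add_two_le hadm hx s
  have hlx := hi_lt s x
  have hhx : hi s x = gnTime P s x + 1 := by
    by_contra hc
    rw [linKey, if_neg (by omega), if_neg (by omega), if_neg (by omega), linKey,
      if_neg (by omega), if_neg (by omega), if_pos (by omega)] at hxk
    omega
  have hright := (linModel hadm s).le_of_right ⟨x, hx⟩ ⟨r, hr⟩
  have hinj := (linModel hadm s).inj ⟨x, hx⟩ ⟨r, hr⟩
  simp only [Subtype.mk.injEq] at hright hinj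
  have := hright hhx.symm (by omega)
  exact hpr (hinj (by omega) (by omega))

theorem mate_succ_iff_left (hadm : IsAdmissible n P) {s : ZMod n}
    (h : gnAssign n P s p = gnAssign n P (s + 1) p) : Mate P s p q ↔ Mate P (s + 1) p q := by
  constructor
  · intro hm
    have hq := hm.gnAssign_pred_right hadm hm.mem_left hm.mem_right h
    obtain ⟨a, h1, h2, h3, h4⟩ := hm
    exact ⟨a, h1, h2, h ▸ h3, hq ▸ h4⟩
  · intro hm
    have hq := hm.gnAssign_succ_right hadm hm.mem_left hm.mem_right h
    obtain ⟨a, h1, h2, h3, h4⟩ := hm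
    exact ⟨a, h1, h2, h ▸ h3, hq ▸ h4⟩

theorem mate_succ_iff_right (hadm : IsAdmissible n P) {s : ZMod n}
    (h : gnAssign n P s p = gnAssign n P (s + 1) p) : Mate P s q p ↔ Mate P (s + 1) q p := by
  constructor
  · intro hm
    have hq := hm.gnAssign_pred_left hadm hm.mem_left hm.mem_right h
    obtain ⟨a, h1, h2, h3, h4⟩ := hm
    exact ⟨a, h1, h2, hq ▸ h3, h ▸ h4⟩
  · intro hm
    have hq := hm.gnAssign_succ_left hadm hm.mem_left hm.mem_right h
    obtain ⟨a, h1, h2, h3, h4⟩ := hm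
    exact ⟨a, h1, h2, hq ▸ h3, h ▸ h4⟩

theorem Mate.mem_Schanged_iff (hadm : IsAdmissible n P) {s : ZMod n} (hm : Mate P s p q) :
    p ∈ Schanged n P s ↔ q ∈ Schanged n P s := by
  have h := Mate.gnAssign_eq_iff (s := s - 1) hadm hm.mem_left hm.mem_right
    (by rwa [sub_add_cancel])
  rw [sub_add_cancel] at h
  simp [Schanged, hm.mem_left, hm.mem_right, h]

/-- Every value `I_i(p)` is acquired at some start `j`, with the same mates as at `i`. -/
theorem exists_mem_Schanged (hadm : IsAdmissible n P) (hp : p ∈ P) (i : ZMod n) :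
    ∃ j, p ∈ Schanged n P j ∧ gnAssign n P j p = gnAssign n P i p ∧
      (∀ q, Mate P j p q ↔ Mate P i p q) ∧ ∀ q, Mate P j q p ↔ Mate P i q p := by
  by_contra hc
  have key : ∀ m : ℕ, gnAssign n P (i - m) p = gnAssign n P i p ∧
      (∀ q, Mate P (i - m) p q ↔ Mate P i p q) ∧ ∀ q, Mate P (i - m) q p ↔ Mate P i q p := by
    intro m
    induction m with
    | zero => simp
    | succ m ih =>
      have h : gnAssign n P (i - m - 1) p = gnAssign n P (i - m - 1 + 1) p := by
        by_contra h
        refine hc ⟨i - m, ?_, ih⟩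
        simpa [Schanged, hp] using h
      rw [show i - ((m + 1 : ℕ) : ZMod n) = i - m - 1 by push_cast; ring]
      refine ⟨?_, fun q => ?_, fun q => ?_⟩
      · rw [h, sub_add_cancel, ih.1]
      · rw [mate_succ_iff_left hadm h, sub_add_cancel, ih.2.1]
      · rw [mate_succ_iff_right hadm h, sub_add_cancel, ih.2.2]
  have h := (key (i - (colOf n P i p + 1)).val).1
  rw [ZMod.natCast_zmod_val, sub_sub_cancel, gnAssign_eq_colOf hadm hp i] at h
  have h1 := gnTime_add_one_lt hadm hp (colOf n P i p + 1)
  have h2 : colOf n P i p = colOf n P i p + 1 + ((n - 1 : ℕ) : ZMod n) := by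
    rw [Nat.cast_sub (Nat.one_le_iff_ne_zero.2 (NeZero.ne n))]
    simp
  have h3 := (gnAssign_eq_some_iff hadm hp (colOf n P i p + 1) (t := n - 1) (by omega)).1
    (h.trans (congrArg some h2))
  omega

/-- A value of the necklace on `p` is acquired at only one start. -/
theorem eq_of_mem_Schanged (hadm : IsAdmissible n P) (hp : p ∈ P) {i j : ZMod n}
    (hi : p ∈ Schanged n P i) (hj : p ∈ Schanged n P j)
    (h : gnAssign n P i p = gnAssign n P j p) : i = j := by
  wlog hij : i.val ≤ j.val generalizing i j
  · exact (this hj hi h.symm (by omega)).symm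
  by_contra hne
  have hv : i.val < j.val := lt_of_le_of_ne hij fun h => hne (ZMod.val_injective n h)
  let L : ℕ → ℕ := fun t => t + gnTime P (t : ZMod n) p
  have hmono : Monotone L := monotone_nat_of_le_succ fun t => by
    have := gnTime_le hadm (t : ZMod n) hp
    simp only [L]
    push_cast
    omega
  have hper : ∀ t, L (t + n) = L t + n := by
    intro t
    simp only [L, Nat.cast_add, ZMod.natCast_self, add_zero]
    omega
  have hassign : ∀ t : ℕ, gnAssign n P (t : ZMod n) p = some ((L t : ℕ) : ZMod n) := by
    intro t
    rw [gnAssign_eq hadm hp]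
    simp [L]
  have hlt : ∀ t : ℕ, p ∈ Schanged n P ((t + 1 : ℕ) : ZMod n) → L t < L (t + 1) := by
    intro t ht
    refine lt_of_le_of_ne (hmono t.le_succ) fun he => ?_
    refine (Finset.mem_filter.1 ht).2 ?_
    rw [show ((t + 1 : ℕ) : ZMod n) - 1 = (t : ℕ) by simp, hassign, hassign, he]
  have hn : 0 < n := Nat.pos_of_ne_zero (NeZero.ne n)
  have cast : ∀ x : ZMod n, ((x.val + n - 1 + 1 : ℕ) : ZMod n) = x := by
    intro x
    rw [Nat.sub_add_cancel (by omega)]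
    simp
  have h1 := hlt (i.val + n - 1) (by rwa [cast])
  have h2 := hlt (j.val + n - 1) (by rwa [cast])
  have hjn := j.val_lt
  have h3 : L (i.val + n - 1 + 1) ≤ L (j.val + n - 1) := hmono (by omega)
  have h4 : L (j.val + n - 1 + 1) ≤ L (i.val + n - 1 + n) := hmono (by omega)
  rw [hper] at h4
  rw [← cast i, ← cast j, hassign, hassign, Option.some_inj,
    ZMod.natCast_eq_natCast_iff] at h
  have h5 := (Nat.modEq_iff_dvd' (by omega)).1 h
  have h6 := Nat.le_of_dvd (by omega) h5
  omega

end Necklace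

section Minors
open MvPolynomial Relation
variable {n : ℕ} {P : Finset (Prp n)} {p q : Prp n}

/-- The `2 × 2` minor of `C(W)` with rows `p`, `q` and columns `a`, `a + 1`. -/
noncomputable def edgeMinor (p q : Prp n) (a : ZMod n) : MvPolynomial (Prp n × ZMod n) ℝ :=
  X (p, a) * X (q, a + 1) - X (p, a + 1) * X (q, a)

theorem colOf_eq_of_gnAssign {s v : ZMod n} (h : gnAssign n P s p = some v) :
    colOf n P s p = v := by
  rw [colOf, h, Option.getD_some]

theorem CW_ne_zero_iff {v : ZMod n} : CW n p v ≠ 0 ↔ v ∈ supp n p := by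
  simp [CW]

theorem CW_of_mem {v : ZMod n} (h : v ∈ supp n p) : CW n p v = X (p, v) := if_pos h

theorem mem_supp_of_mem {a : ZMod n} (h : a ∈ p) : a ∈ supp n p ∧ a + 1 ∈ supp n p :=
  ⟨(mem_supp_iff _ _).2 (Or.inl h), (mem_supp_iff _ _).2 (Or.inr (by simpa using h))⟩

theorem isHomogeneous_minor (S : Finset (Prp n)) (c : Prp n → ZMod n) :
    (Matrix.det (Matrix.of fun p q : ↥S => CW n (p : Prp n) (c q))).IsHomogeneous S.card := by
  rw [← Fintype.card_coe]
  refine isHomogeneous_det _ fun p q => ?_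
  rw [Matrix.of_apply, CW]
  split_ifs
  · exact isHomogeneous_X _ _
  · exact isHomogeneous_zero _ _ _

theorem add_one_ne (hadm : IsAdmissible n P) (a : ZMod n) : a + 1 ≠ a ∧ a + 1 + 1 ≠ a := by
  have h : ∀ m : ℕ, m < 3 → 0 < m → a + (m : ZMod n) ≠ a := by
    intro m hm hm0 he
    have hn := hadm.card_add_four_le
    rw [add_eq_left, ZMod.natCast_eq_zero_iff] at he
    have := Nat.le_of_dvd hm0 he
    omega
  have h1 := h 1 (by norm_num) (by norm_num)
  have h2 := h 2 (by norm_num) (by norm_num)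
  rw [add_assoc, one_add_one_eq_two]
  exact_mod_cast And.intro h1 h2

theorem edgeMinor_swap (p q : Prp n) (a : ZMod n) : edgeMinor q p a = -edgeMinor p q a := by
  rw [edgeMinor, edgeMinor]
  ring

theorem irreducible_edgeMinor (hadm : IsAdmissible n P) (hpq : p ≠ q) (a : ZMod n) :
    Irreducible (edgeMinor p q a) := by
  have := (add_one_ne hadm a).1
  apply irreducible_minor <;> simp [hpq, hpq.symm, this, this.symm]

theorem vars_edgeMinor (hadm : IsAdmissible n P) (hpq : p ≠ q) (a : ZMod n) :
    (edgeMinor p q a).vars = {(p, a), (q, a + 1), (p, a + 1), (q, a)} := by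
  have := (add_one_ne hadm a).1
  apply vars_minor <;> simp [hpq, this.symm]

theorem not_associated_edgeMinor_X (hadm : IsAdmissible n P) (hpq : p ≠ q) (a : ZMod n)
    (x : Prp n × ZMod n) : ¬ Associated (edgeMinor p q a) (X x) := by
  intro h
  have h1 := vars_eq_of_associated h
  rw [vars_edgeMinor hadm hpq, vars_X] at h1
  have h2 : (p, a) ∈ ({x} : Finset _) := h1 ▸ by simp
  have h3 : (q, a) ∈ ({x} : Finset _) := h1 ▸ by simp
  rw [Finset.mem_singleton] at h2 h3
  exact hpq (congrArg Prod.fst (h2.trans h3.symm))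

theorem edgeMinor_associated (hadm : IsAdmissible n P) {p' q' : Prp n} {a b : ZMod n}
    (hpq : p ≠ q) (hpq' : p' ≠ q') (h : Associated (edgeMinor p q a) (edgeMinor p' q' b)) :
    a = b ∧ (p = p' ∧ q = q' ∨ p = q' ∧ q = p') := by
  have h1 := vars_eq_of_associated h
  rw [vars_edgeMinor hadm hpq, vars_edgeMinor hadm hpq', Finset.ext_iff] at h1
  simp only [Finset.mem_insert, Finset.mem_singleton] at h1
  have h2 := (h1 (p, a)).1 (Or.inl rfl)
  have h3 := (h1 (q, a)).1 (Or.inr (Or.inr (Or.inr rfl)))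
  have h4 := (h1 (p, a + 1)).1 (Or.inr (Or.inr (Or.inl rfl)))
  simp only [Prod.mk.injEq] at h2 h3 h4
  have hab : a = b := by
    have h5 : a = b ∨ a = b + 1 := by
      rcases h2 with h | h | h | h <;> simp [h.2]
    rcases h5 with h5 | rfl
    · exact h5
    · have h6 := add_one_ne hadm b
      have h7 := (add_one_ne hadm (b + 1)).1
      rcases h4 with h | h | h | h
      · exact absurd h.2 h6.2
      · exact absurd h.2 h7
      · exact absurd h.2 h7
      · exact absurd h.2 h6.2
  have h6 : p = p' ∨ p = q' := by rcases h2 with h | h | h | h <;> simp [h.1]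
  have h7 : q = p' ∨ q = q' := by rcases h3 with h | h | h | h <;> simp [h.1]
  refine ⟨hab, ?_⟩
  rcases h6 with rfl | rfl <;> rcases h7 with rfl | rfl
  · exact absurd rfl hpq
  · exact Or.inl ⟨rfl, rfl⟩
  · exact Or.inr ⟨rfl, rfl⟩
  · exact absurd rfl hpq

/-- The factor of `Δ_{I_s}` contributed by the propagator `p`. -/
noncomputable def fac (P : Finset (Prp n)) (s : ZMod n) (p : Prp n) :
    MvPolynomial (Prp n × ZMod n) ℝ :=
  pairFactor (Matrix.of fun p q : Prp n => CW n p (colOf n P s q)) (Mate P s) p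

theorem fac_of_mate_right (hadm : IsAdmissible n P) {s : ZMod n} (hm : Mate P s q p) :
    fac P s p = 1 :=
  pairFactor_high _ _ hm fun _ => not_mate_mate hadm hm.mem_right hm

variable [NeZero n]

theorem fac_of_mate (hadm : IsAdmissible n P) {s a : ZMod n} (hap : a ∈ p) (haq : a ∈ q)
    (h1 : gnAssign n P s p = some a) (h2 : gnAssign n P s q = some (a + 1)) :
    fac P s p = edgeMinor p q a := by
  have hm : Mate P s p q := ⟨a, hap, haq, h1, h2⟩
  rw [fac, pairFactor_low _ _ hm fun r hr => mate_right_unique hadm hm.mem_right hr.mem_right hm hr]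
  simp only [Matrix.of_apply, colOf_eq_of_gnAssign h1, colOf_eq_of_gnAssign h2]
  rw [CW_of_mem (mem_supp_of_mem hap).1, CW_of_mem (mem_supp_of_mem hap).2,
    CW_of_mem (mem_supp_of_mem haq).1, CW_of_mem (mem_supp_of_mem haq).2, edgeMinor]

theorem fac_of_not_mate (hadm : IsAdmissible n P) (hp : p ∈ P) {s : ZMod n}
    (h1 : ∀ q, ¬ Mate P s p q) (h2 : ∀ q, ¬ Mate P s q p) :
    fac P s p = X (p, colOf n P s p) := by
  rw [fac, pairFactor_single _ _ h2 h1, Matrix.of_apply, CW_of_mem (colOf_mem_supp hadm hp s)]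

theorem fac_cases (hadm : IsAdmissible n P) (hp : p ∈ P) (s : ZMod n) :
    (∃ q ∈ P, ∃ a, a ∈ p ∧ a ∈ q ∧ gnAssign n P s p = some a ∧ gnAssign n P s q = some (a + 1) ∧
        p ≠ q ∧ fac P s p = edgeMinor p q a) ∨
      fac P s p = 1 ∨ fac P s p = X (p, colOf n P s p) := by
  by_cases h1 : ∃ q, Mate P s p q
  · obtain ⟨q, hm⟩ := h1
    obtain ⟨a, hap, haq, h1, h2⟩ := id hm
    refine Or.inl ⟨q, hm.mem_right, a, hap, haq, h1, h2, ?_, fac_of_mate hadm hap haq h1 h2⟩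
    rintro rfl
    exact not_mate_mate hadm hm.mem_right hm hm
  · by_cases h2 : ∃ q, Mate P s q p
    · exact Or.inr (Or.inl (h2.elim fun q => fac_of_mate_right hadm))
    · exact Or.inr (Or.inr (fac_of_not_mate hadm hp (not_exists.1 h1) (not_exists.1 h2)))

theorem fac_congr (hadm : IsAdmissible n P) (hp : p ∈ P) {i j : ZMod n}
    (h : gnAssign n P j p = gnAssign n P i p) (h1 : ∀ q, Mate P j p q ↔ Mate P i p q)
    (h2 : ∀ q, Mate P j q p ↔ Mate P i q p) : fac P j p = fac P i p := by
  by_cases h3 : ∃ q, Mate P i p q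
  · obtain ⟨q, hm⟩ := h3
    obtain ⟨a, hap, haq, h4, h5⟩ := (h1 q).2 hm
    obtain ⟨b, hbp, hbq, h6, h7⟩ := hm
    obtain rfl : a = b := Option.some_inj.1 (h4.symm.trans (h.trans h6))
    rw [fac_of_mate hadm hap haq h4 h5, fac_of_mate hadm hap haq h6 h7]
  · by_cases h4 : ∃ q, Mate P i q p
    · obtain ⟨q, hm⟩ := h4
      rw [fac_of_mate_right hadm hm, fac_of_mate_right hadm ((h2 q).2 hm)]
    · push Not at h3 h4
      rw [fac_of_not_mate hadm hp h3 h4, fac_of_not_mate hadm hp (fun q => mt (h1 q).1 (h3 q))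
        (fun q => mt (h2 q).1 (h4 q)), colOf, colOf, h, gnAssign_eq hadm hp,
        Option.getD_some, Option.getD_some]

theorem mate_of_mates (hadm : IsAdmissible n P) {s : ZMod n} (p q : ↥P)
    (h : LinModel.Mates (fun p : ↥P => lo s p) (fun p => hi s p) (fun p => gnTime P s p) p q) :
    Mate P s p q := by
  obtain ⟨e, h1, h2, h3, h4⟩ := h
  rw [mate_iff hadm p.2 q.2]
  dsimp only at h1 h2 h3 h4
  omega

theorem det_minor_eq_prod (hadm : IsAdmissible n P) {S : Finset (Prp n)} (hSP : S ⊆ P) (s : ZMod n)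
    (hS : ∀ p q, Mate P s p q → (p ∈ S ↔ q ∈ S)) :
    Matrix.det (Matrix.of fun p q : ↥S => CW n (p : Prp n) (colOf n P s (q : Prp n))) =
      ∏ p ∈ S, fac P s p := by
  rw [det_eq_prod_pairFactor _ (fun p q : ↥S => Mate P s p q), ← Finset.prod_coe_sort S (fac P s)]
  · refine Finset.prod_congr rfl fun p _ => ?_
    by_cases h1 : ∃ q, Mate P s p q
    · obtain ⟨q, hm⟩ := h1
      have hu : ∀ r, Mate P s p r → r = q := fun r hr =>
        mate_right_unique hadm hm.mem_right hr.mem_right hm hr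
      rw [fac, pairFactor_low _ _ hm hu,
        pairFactor_low _ _ (q := ⟨q, (hS _ _ hm).1 p.2⟩) hm fun r hr => Subtype.ext (hu r hr)]
      rfl
    · by_cases h2 : ∃ q, Mate P s q p
      · obtain ⟨q, hm⟩ := h2
        rw [fac_of_mate_right hadm hm]
        have hq : q ∈ S := (hS _ _ hm).2 p.2
        exact pairFactor_high _ (fun p q : ↥S => Mate P s p q) (p := p) (q := ⟨q, hq⟩) hm
          fun r hr => h1 ⟨r, hr⟩
      · push Not at h1 h2
        rw [fac, pairFactor_single _ _ h2 h1]
        exact pairFactor_single _ (fun p q : ↥S => Mate P s p q) (p := p) (fun q => h2 q)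
          fun q => h1 q
  · intro p q hne h1 h2
    let ι : ↥S → ↥P := fun p => ⟨p, hSP p.2⟩
    have hι : ∀ x y : ↥S, CW n (y : Prp n) (colOf n P s (x : Prp n)) ≠ 0 →
        LinModel.Edge (fun p : ↥P => lo s p) (fun p => hi s p) (fun p => gnTime P s p)
          (ι x) (ι y) := by
      intro x y h
      rwa [CW_ne_zero_iff, colOf_eq hadm (hSP x.2), mem_supp_iff_meets s _
        (gnTime_add_one_lt hadm (hSP x.2) s)] at h
    have h3 := (linModel hadm s).mates_of_reach (ι p) (ι q)
      (fun h => hne (Subtype.ext (congrArg (fun x : ↥P => (x : Prp n)) h))) (h1.lift ι hι) (h2.lift ι hι)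
    exact h3.imp (mate_of_mates hadm _ _) (mate_of_mates hadm _ _)
  · rintro p q ⟨a, hap, haq, h1, h2⟩
    simp only [Matrix.of_apply, CW_ne_zero_iff, colOf_eq_of_gnAssign h1, colOf_eq_of_gnAssign h2]
    exact ⟨(mem_supp_of_mem hap).2, (mem_supp_of_mem haq).1⟩
  · intro p q r h1 h2
    exact Subtype.ext (mate_right_unique hadm h1.mem_right h2.mem_right h1 h2)
  · intro p q r h1
    exact not_mate_mate hadm h1.mem_right h1

theorem Delta_eq_prod (hadm : IsAdmissible n P) (s : ZMod n) :
    Delta n P s = ∏ p ∈ P, fac P s p :=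
  det_minor_eq_prod hadm subset_rfl s fun _ _ h => iff_of_true h.mem_left h.mem_right

theorem rfac_eq_prod (hadm : IsAdmissible n P) (s : ZMod n) :
    rfac n P s = ∏ p ∈ Schanged n P s, fac P s p :=
  det_minor_eq_prod hadm (Finset.filter_subset _ _) s fun _ _ h => h.mem_Schanged_iff hadm

theorem rfac_dvd_Delta (hadm : IsAdmissible n P) (s : ZMod n) : rfac n P s ∣ Delta n P s := by
  rw [rfac_eq_prod hadm, Delta_eq_prod hadm]
  exact Finset.prod_dvd_prod_of_subset _ _ _ (Finset.filter_subset _ _)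

theorem fac_dvd_Rpoly (hadm : IsAdmissible n P) (hp : p ∈ P) (i : ZMod n) :
    fac P i p ∣ Rpoly n P := by
  obtain ⟨j, hj, h, h1, h2⟩ := exists_mem_Schanged hadm hp i
  rw [← fac_congr hadm hp h h1 h2]
  refine dvd_trans ?_ (Finset.dvd_prod_of_mem _ (Finset.mem_univ j))
  rw [rfac_eq_prod hadm]
  exact Finset.dvd_prod_of_mem _ hj

theorem fac_irreducible_or (hadm : IsAdmissible n P) (hp : p ∈ P) (s : ZMod n) :
    Irreducible (fac P s p) ∨ fac P s p = 1 := by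
  rcases fac_cases hadm hp s with ⟨q, -, a, -, -, -, -, hpq, h⟩ | h | h
  · rw [h]
    exact Or.inl (irreducible_edgeMinor hadm hpq a)
  · exact Or.inr h
  · rw [h]
    exact Or.inl (X_prime).irreducible

theorem eq_of_fac_associated (hadm : IsAdmissible n P) {i j : ZMod n} (hp : p ∈ Schanged n P i)
    (hq : q ∈ Schanged n P j) (hirr : Irreducible (fac P i p))
    (h : Associated (fac P i p) (fac P j q)) : i = j ∧ p = q := by
  have hpP := (Finset.mem_filter.1 hp).1
  have hqP := (Finset.mem_filter.1 hq).1
  have hirr' := h.irreducible hirr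
  rcases fac_cases hadm hpP i with ⟨p', hp', a, h1, h2, h3, h4, hne, hf⟩ | hf | hf
  · rcases fac_cases hadm hqP j with ⟨q', hq', b, k1, k2, k3, k4, kne, kf⟩ | kf | kf
    · rw [hf, kf] at h
      obtain ⟨rfl, ⟨rfl, rfl⟩ | ⟨rfl, rfl⟩⟩ := edgeMinor_associated hadm hne kne h
      · exact ⟨eq_of_mem_Schanged hadm hpP hp hq (h3.trans k3.symm), rfl⟩
      · have := mate_cwKey_lt hadm hpP hqP h1 h2 h3 h4
        have := mate_cwKey_lt hadm hqP hpP h2 h1 k3 k4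
        omega
    · rw [kf] at hirr'
      exact absurd isUnit_one hirr'.not_isUnit
    · rw [hf, kf] at h
      exact absurd h (not_associated_edgeMinor_X hadm hne _ _)
  · rw [hf] at hirr
    exact absurd isUnit_one hirr.not_isUnit
  · rcases fac_cases hadm hqP j with ⟨q', hq', b, k1, k2, k3, k4, kne, kf⟩ | kf | kf
    · rw [hf, kf] at h
      exact absurd h.symm (not_associated_edgeMinor_X hadm kne _ _)
    · rw [kf] at hirr'
      exact absurd isUnit_one hirr'.not_isUnit
    · rw [hf, kf] at h
      have h1 := vars_eq_of_associated h
      rw [vars_X, vars_X, Finset.singleton_inj, Prod.mk.injEq] at h1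
      obtain ⟨rfl, h1⟩ := h1
      refine ⟨eq_of_mem_Schanged hadm hpP hp hq ?_, rfl⟩
      rw [gnAssign_eq_colOf hadm hpP, gnAssign_eq_colOf hadm hpP, h1]

theorem squarefree_Rpoly (hadm : IsAdmissible n P) : Squarefree (Rpoly n P) := by
  have h : Rpoly n P = ∏ x ∈ Finset.univ.sigma (Schanged n P), fac P x.1 x.2 := by
    rw [Finset.prod_sigma]
    exact Finset.prod_congr rfl fun i _ => rfac_eq_prod hadm i
  rw [h]
  have hmem : ∀ x ∈ Finset.univ.sigma (Schanged n P), x.2 ∈ P := fun x hx =>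
    (Finset.mem_filter.1 (Finset.mem_sigma.1 hx).2).1
  refine Finset.squarefree_prod_of_pairwise_isCoprime ?_ fun x hx => ?_
  · intro x hx y hy hxy
    rcases fac_irreducible_or hadm (hmem x hx) x.1 with h1 | h1
    · refine (h1.isRelPrime_iff_not_dvd).2 fun h2 => hxy ?_
      rcases fac_irreducible_or hadm (hmem y hy) y.1 with h3 | h3
      · obtain ⟨h4, h5⟩ := eq_of_fac_associated hadm (Finset.mem_sigma.1 hx).2
          (Finset.mem_sigma.1 hy).2 h1 (h1.associated_of_dvd h3 h2)
        exact Sigma.ext h4 (heq_of_eq h5)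
      · exact absurd (isUnit_of_dvd_one (h3 ▸ h2)) h1.not_isUnit
    · simp only [Function.onFun, h1]
      exact isRelPrime_one_left
  · rcases fac_irreducible_or hadm (hmem x hx) x.1 with h1 | h1
    · exact h1.squarefree
    · rw [h1]
      exact squarefree_one

theorem span_Rpoly_eq_radical (hadm : IsAdmissible n P) :
    Ideal.span {Rpoly n P} = (Ideal.span {∏ i : ZMod n, Delta n P i}).radical := by
  refine span_eq_radical_of_squarefree (N := n * P.card) (squarefree_Rpoly hadm)
    (Finset.prod_dvd_prod_of_dvd _ _ fun i _ => rfac_dvd_Delta hadm i) ?_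
  have h : ∀ i, Delta n P i ∣ Rpoly n P ^ P.card := fun i => by
    rw [Delta_eq_prod hadm, ← Finset.prod_const]
    exact Finset.prod_dvd_prod_of_dvd _ _ fun p hp => fac_dvd_Rpoly hadm hp i
  calc ∏ i : ZMod n, Delta n P i ∣ ∏ _i : ZMod n, Rpoly n P ^ P.card :=
        Finset.prod_dvd_prod_of_dvd _ _ fun i _ => h i
    _ = Rpoly n P ^ (n * P.card) := by
        rw [Finset.prod_const, Finset.card_univ, ZMod.card, ← pow_mul, mul_comm]

theorem exists_fac_associated (hadm : IsAdmissible n P) {s : ZMod n}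
    {f : MvPolynomial (Prp n × ZMod n) ℝ} (hf : Irreducible f) (h : f ∣ Delta n P s) :
    ∃ p ∈ P, Associated f (fac P s p) := by
  rw [Delta_eq_prod hadm] at h
  obtain ⟨p, hp, h1⟩ := (Prime.dvd_finsetProd_iff hf.prime _).1 h
  refine ⟨p, hp, ?_⟩
  rcases fac_irreducible_or hadm hp s with h2 | h2
  · exact hf.associated_of_dvd h2 h1
  · rw [h2] at h1
    exact absurd (isUnit_of_dvd_one h1) hf.not_isUnit

theorem edgeMinor_dvd_Delta (hadm : IsAdmissible n P) {s a : ZMod n} (hap : a ∈ p) (haq : a ∈ q)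
    (h1 : gnAssign n P s p = some a) (h2 : gnAssign n P s q = some (a + 1)) :
    edgeMinor p q a ∣ Delta n P s := by
  rw [Delta_eq_prod hadm, ← fac_of_mate hadm hap haq h1 h2]
  exact Finset.dvd_prod_of_mem _ (mem_of_gnAssign h1)

theorem edgeMinor_dvd_Delta_iff (hadm : IsAdmissible n P) {s a : ZMod n} (hpq : p ≠ q) :
    edgeMinor p q a ∣ Delta n P s ↔ a ∈ p ∧ a ∈ q ∧
      ((gnAssign n P s p = some a ∧ gnAssign n P s q = some (a + 1)) ∨
        (gnAssign n P s q = some a ∧ gnAssign n P s p = some (a + 1))) := by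
  constructor
  · intro h
    obtain ⟨r, hr, h1⟩ := exists_fac_associated hadm (irreducible_edgeMinor hadm hpq a) h
    rcases fac_cases hadm hr s with ⟨r', -, b, k1, k2, k3, k4, hne, hf⟩ | hf | hf
    · rw [hf] at h1
      obtain ⟨rfl, ⟨rfl, rfl⟩ | ⟨rfl, rfl⟩⟩ := edgeMinor_associated hadm hpq hne h1
      · exact ⟨k1, k2, Or.inl ⟨k3, k4⟩⟩
      · exact ⟨k2, k1, Or.inr ⟨k3, k4⟩⟩
    · rw [hf] at h1
      exact absurd (h1.symm.isUnit isUnit_one) (irreducible_edgeMinor hadm hpq a).not_isUnit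
    · rw [hf] at h1
      exact absurd h1 (not_associated_edgeMinor_X hadm hpq _ _)
  · rintro ⟨h1, h2, ⟨h3, h4⟩ | ⟨h3, h4⟩⟩
    · exact edgeMinor_dvd_Delta hadm h1 h2 h3 h4
    · rw [edgeMinor_swap q p, neg_dvd]
      exact edgeMinor_dvd_Delta hadm h2 h1 h3 h4

end Minors

/-- structure of the necklace minors `Δ_{I_i}` and of the
factors `r_i`.  Let `W = (P, [n])` be an admissible Wilson loop diagram with
`k` propagators, Grassmann necklace `(I_1^W, …, I_n^W)`, and notation as in the
Algorithm.  Then: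
(1) each `Δ_{I_i}` and each `r_i` is a homogeneous polynomial;
(2) each `Δ_{I_i}` factors into irreducible factors of degree at most 2: every
linear (irreducible) factor is a single variable `x_{p,a}` and every irreducible
quadratic factor is a `2×2` minor of `C(W)` of the form
`x_{p,a} x_{q,a+1} - x_{p,a+1} x_{q,a}`;
(3) an irreducible quadratic factor of `Δ_{I_i}` arises precisely when two
propagators `p` and `q` are supported on a common edge `a` with `I_i(p) = a`
and `I_i(q) = a+1`;
(4) `r_i` divides `Δ_{I_i}` for every `i`;
(5) the ideal generated by `R = ∏ᵢ rᵢ` is the radical of the ideal generated by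
`∏ᵢ Δ_{I_i}` in the polynomial ring in the variables `x_{p,q}`. -/
theorem delta_structure_and_radical
    (n : ℕ) [NeZero n] (P : Finset (Prp n)) (hadm : IsAdmissible n P) :
    (∀ i : ZMod n, (Delta n P i).IsHomogeneous P.card ∧
        (rfac n P i).IsHomogeneous (Schanged n P i).card) ∧
    (∀ i : ZMod n, ∀ f : MvPolynomial (Prp n × ZMod n) ℝ,
      Irreducible f → f ∣ Delta n P i →
        (∃ p ∈ P, ∃ a : ZMod n, a ∈ supp n p ∧
          Associated f (MvPolynomial.X (p, a))) ∨
        (∃ p ∈ P, ∃ q ∈ P, ∃ a : ZMod n, a ∈ p ∧ a ∈ q ∧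
          Associated f
            (MvPolynomial.X (p, a) * MvPolynomial.X (q, a + 1) -
              MvPolynomial.X (p, a + 1) * MvPolynomial.X (q, a)))) ∧
    (∀ i : ZMod n, ∀ p ∈ P, ∀ q ∈ P, ∀ a : ZMod n, p ≠ q →
      ((MvPolynomial.X (p, a) * MvPolynomial.X (q, a + 1) -
          MvPolynomial.X (p, a + 1) * MvPolynomial.X (q, a)) ∣ Delta n P i ↔
        (a ∈ p ∧ a ∈ q ∧
          ((gnAssign n P i p = some a ∧ gnAssign n P i q = some (a + 1)) ∨
           (gnAssign n P i q = some a ∧ gnAssign n P i p = some (a + 1)))))) ∧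
    (∀ i : ZMod n, rfac n P i ∣ Delta n P i) ∧
    Ideal.span {Rpoly n P} = (Ideal.span {∏ i : ZMod n, Delta n P i}).radical := by
  refine ⟨fun i => ⟨isHomogeneous_minor P _, isHomogeneous_minor _ _⟩, fun i f hf hd => ?_,
    fun i p _ q _ a hpq => edgeMinor_dvd_Delta_iff hadm hpq, rfac_dvd_Delta hadm,
    span_Rpoly_eq_radical hadm⟩
  obtain ⟨p, hp, h⟩ := exists_fac_associated hadm hf hd
  rcases fac_cases hadm hp i with ⟨q, hq, a, h1, h2, -, -, -, he⟩ | he | he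
  · exact Or.inr ⟨p, hp, q, hq, a, h1, h2, h.trans (.of_eq he)⟩
  · exact absurd (h.symm.isUnit (he ▸ isUnit_one)) hf.not_isUnit
  · exact Or.inl ⟨p, hp, _, colOf_mem_supp hadm hp i, h.trans (.of_eq he)⟩

end WLD
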